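/- arXiv:0806.1036 — 8 statements merged into one kernel-verified Lean document; each statement's English description precedes it below -/
import Mathlib

section
/- Let (V, ω) be a symplectic vector space and let H = ℓ²(V, ℂ) be the Hilbert space of square-summable complex-valued functions on the set V (that is, L² of the counting measure on V). Then there exists a map W from V into the bounded linear operators on H such that for all φ, ψ ∈ V and all F ∈ H one has (W(φ)F)(ψ) = exp(i·ω(φ, ψ)/2)·F(φ + ψ), and the pair (B(H), W) is a Weyl system of (V, ω): W(0) = id_H, W(−φ) = W(φ)* (the Hilbert space adjoint) for all φ ∈ V, and W(φ)∘W(ψ) = exp(−i·ω(φ, ψ)/2)·W(φ + ψ) for all φ, ψ ∈ V. In particular, every symplectic vector space admits a Weyl system. -/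
/-- Let `(V, ω)` be a symplectic vector space and let
`H = ℓ²(V, ℂ)` be the Hilbert space of square-summable complex-valued functions on
the set `V`.  Then there exists a map `W` from `V` into the bounded linear operators
on `H` such that `(W φ F) ψ = exp(i ω(φ,ψ)/2) · F(φ + ψ)` for all `φ, ψ ∈ V` and
`F ∈ H`, and `(B(H), W)` is a Weyl system of `(V, ω)`:  `W 0 = id`,
`W (-φ) = W(φ)*`, and `W φ ∘ W ψ = exp(-i ω(φ,ψ)/2) · W(φ+ψ)`.
In particular, every symplectic vector space admits a Weyl system. -/
theorem every_symplectic_vector_space_admits_a_weyl_system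
    (V : Type) [AddCommGroup V] [Module ℝ V]
    (ω : V →ₗ[ℝ] V →ₗ[ℝ] ℝ)
    (hanti : ∀ φ ψ : V, ω φ ψ = - ω ψ φ)
    (hnondeg : ∀ φ : V, (∀ ψ : V, ω φ ψ = 0) → φ = 0) :
    ∃ W : V → (lp (fun _ : V => ℂ) 2 →L[ℂ] lp (fun _ : V => ℂ) 2),
      (∀ (φ ψ : V) (F : lp (fun _ : V => ℂ) 2),
          (W φ F) ψ = Complex.exp (Complex.I * (ω φ ψ : ℂ) / 2) * F (φ + ψ)) ∧
      W 0 = 1 ∧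
      (∀ φ : V, W (-φ) = star (W φ)) ∧
      (∀ φ ψ : V,
          W φ * W ψ = Complex.exp (-(Complex.I * (ω φ ψ : ℂ)) / 2) • W (φ + ψ)) := by
  classical
  let c : V → V → ℂ := fun φ ψ => Complex.exp (Complex.I * (ω φ ψ : ℂ) / 2)
  have hself : ∀ φ : V, ω φ φ = 0 := fun φ => by linarith [hanti φ φ]
  have hc : ∀ φ ψ, ‖c φ ψ‖ = 1 := fun φ ψ => by
    have : Complex.I * (ω φ ψ : ℂ) / 2 = ((ω φ ψ / 2 : ℝ) : ℂ) * Complex.I := by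
      push_cast; ring
    simp only [c]
    rw [this, Complex.norm_exp_ofReal_mul_I]
  have hp : 0 < (2 : ENNReal).toReal := by norm_num
  have hnorm : ∀ (φ : V) (F : V → ℂ) (ψ : V), ‖c φ ψ * F (φ + ψ)‖ = ‖F (φ + ψ)‖ := by
    intro φ F ψ
    rw [norm_mul, hc, one_mul]
  have hmem : ∀ (φ : V) (F : lp (fun _ : V => ℂ) 2),
      Memℓp (fun ψ : V => c φ ψ * F (φ + ψ)) 2 := by
    intro φ F
    refine memℓp_gen ?_
    simp only [hnorm]
    exact ((lp.memℓp F).summable hp).comp_injective (Equiv.addLeft φ).injective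
  let L : V → (lp (fun _ : V => ℂ) 2 →ₗ[ℂ] lp (fun _ : V => ℂ) 2) := fun φ =>
    { toFun := fun F => ⟨fun ψ : V => c φ ψ * F (φ + ψ), hmem φ F⟩
      map_add' := by
        intro F G
        ext ψ
        exact mul_add _ _ _
      map_smul' := by
        intro a F
        ext ψ
        exact mul_left_comm _ _ _ }
  have hL : ∀ φ F ψ, (L φ F) ψ = c φ ψ * F (φ + ψ) := fun _ _ _ => rfl
  have hLn : ∀ φ F, ‖L φ F‖ ≤ 1 * ‖F‖ := by
    intro φ F
    rw [one_mul, lp.norm_eq_tsum_rpow hp, lp.norm_eq_tsum_rpow hp]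
    simp only [hL, hnorm]
    exact le_of_eq (congrArg (fun x : ℝ => x ^ (1 / (2 : ENNReal).toReal))
      ((Equiv.addLeft φ).tsum_eq (fun ψ => ‖F ψ‖ ^ (2 : ENNReal).toReal)))
  let W : V → (lp (fun _ : V => ℂ) 2 →L[ℂ] lp (fun _ : V => ℂ) 2) := fun φ =>
    (L φ).mkContinuous 1 (hLn φ)
  have hW : ∀ φ F ψ, (W φ F) ψ = c φ ψ * F (φ + ψ) := fun _ _ _ => rfl
  refine ⟨W, fun φ ψ F => hW φ F ψ, ?_, ?_, ?_⟩
  · ext F ψ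
    rw [hW]
    simp [c]
  · intro φ
    rw [ContinuousLinearMap.star_eq_adjoint, ContinuousLinearMap.eq_adjoint_iff]
    intro F G
    rw [lp.inner_eq_tsum, lp.inner_eq_tsum, ← (Equiv.addLeft φ).tsum_eq]
    refine tsum_congr fun χ => ?_
    have hcc : (starRingEnd ℂ) (c (-φ) (φ + χ)) = c φ χ := by
      simp only [c]
      rw [← Complex.exp_conj]
      congr 1
      have h2 : (starRingEnd ℂ) 2 = 2 := Complex.conj_ofNat 2
      simp [hself, h2]
    rw [hW, hW, Equiv.coe_addLeft, RCLike.inner_apply, RCLike.inner_apply, map_mul, hcc,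
      neg_add_cancel_left]
    ring
  · intro φ ψ
    ext F χ
    change (W φ (W ψ F)) χ = Complex.exp (-(Complex.I * (ω φ ψ : ℂ)) / 2) * (W (φ + ψ) F) χ
    rw [hW, hW, hW, ← mul_assoc, ← mul_assoc]
    simp only [c]
    rw [← Complex.exp_add, ← Complex.exp_add]
    congr 2
    · rw [map_add, map_add, LinearMap.add_apply, hanti ψ φ]
      push_cast
      ring
    · abel_nf
end

section
/- Let (V, ω) be a symplectic vector space and let (A, W) be a CCR-representation of (V, ω). Let B be a unital C*-algebra in which 1 ≠ 0, and let π : A → B be a unit-preserving *-homomorphism (an algebra homomorphism with π(1) = 1 and π(a*) = π(a)* for all a ∈ A). Then π is injective. -/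
open Filter Topology Finset

namespace CCRaux

/-- The character by which conjugation by `W ψ` acts on `W φ`. -/
noncomputable def chi {V : Type*} [AddCommGroup V] [Module ℝ V]
    (ω : V →ₗ[ℝ] V →ₗ[ℝ] ℝ) (ψ φ : V) : ℂ := Complex.exp (((-(ω ψ φ) : ℝ) : ℂ) * Complex.I)

section chi
variable {V : Type*} [AddCommGroup V] [Module ℝ V] (ω : V →ₗ[ℝ] V →ₗ[ℝ] ℝ)

lemma norm_chi (ψ φ : V) : ‖chi ω ψ φ‖ = 1 := Complex.norm_exp_ofReal_mul_I _

lemma chi_nsmul (n : ℕ) (ψ φ : V) : chi ω (n • ψ) φ = chi ω ψ φ ^ n := by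
  unfold chi
  rw [← Complex.exp_nat_mul]
  congr 1
  simp
  ring

lemma chi_add (ψ ψ' φ : V) : chi ω (ψ + ψ') φ = chi ω ψ φ * chi ω ψ' φ := by
  unfold chi
  rw [← Complex.exp_add]
  congr 1
  simp
  ring

lemma exists_sep (hanti : ∀ φ ψ : V, ω φ ψ = - ω ψ φ)
    (hnondeg : ∀ φ : V, (∀ ψ : V, ω φ ψ = 0) → φ = 0) (s : Finset V) :
    ∃ ψ : V, Set.InjOn (fun φ => chi ω ψ φ) s := by
  classical
  obtain ⟨ψ, hψ⟩ := Module.Dual.exists_forall_ne_zero_of_forall_exists (K := ℝ) (M := V)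
    (ι := {p : s × s // p.1 ≠ p.2}) (fun p => ω ((p.1.1 : V) - (p.1.2 : V))) (by
      rintro ⟨⟨a, b⟩, hab⟩
      by_contra! h
      have := hnondeg _ h
      exact hab (Subtype.ext (sub_eq_zero.mp this)))
  set M : ℝ := 1 + ∑ φ ∈ s, |ω ψ φ| with hM
  have hMpos : 0 < M := by positivity
  refine ⟨M⁻¹ • ψ, ?_⟩
  have hb : ∀ φ ∈ s, |M⁻¹ * ω ψ φ| ≤ 1 := by
    intro φ hφ
    rw [abs_mul, abs_of_pos (inv_pos.mpr hMpos), inv_mul_le_iff₀ hMpos]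
    have := Finset.single_le_sum (f := fun φ => |ω ψ φ|) (fun _ _ => abs_nonneg _) hφ
    linarith
  intro a ha b hb' hab
  by_contra hne
  have h1 := hψ ⟨(⟨a, ha⟩, ⟨b, hb'⟩), fun h => hne (by simpa using h)⟩
  apply h1
  have ha1 := abs_le.mp (hb a ha)
  have hb1 := abs_le.mp (hb b hb')
  have hpi := Real.pi_gt_three
  simp only [chi] at hab
  have := Complex.exp_inj_of_neg_pi_lt_of_le_pi (by simp; linarith) (by simp; linarith)
    (by simp; linarith) (by simp; linarith) hab
  have h2 := congrArg Complex.im this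
  simp at h2
  have h3 : ω ψ a = ω ψ b := by
    rcases h2 with h2 | h2
    · exact h2
    · exact absurd h2 hMpos.ne'
  have e1 := hanti a ψ
  have e2 := hanti b ψ
  simp
  linarith
end chi

lemma tendsto_avg (z : ℂ) (hz : ‖z‖ = 1) :
    Tendsto (fun N : ℕ => (N : ℂ)⁻¹ * ∑ n ∈ range N, z ^ n) atTop
      (𝓝 (if z = 1 then 1 else 0)) := by
  split_ifs with h
  · subst h
    refine tendsto_const_nhds.congr' ?_
    filter_upwards [eventually_gt_atTop 0] with N hN
    have : (N : ℂ) ≠ 0 := by exact_mod_cast hN.ne'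
    simp [this]
  · have h0 : Tendsto (fun N : ℕ => (N : ℝ)⁻¹ * (2 / ‖z - 1‖)) atTop (𝓝 0) := by
      simpa using (tendsto_inv_atTop_nhds_zero_nat (𝕜 := ℝ)).mul_const (2 / ‖z - 1‖)
    refine squeeze_zero_norm (fun N => ?_) h0
    rw [geom_sum_eq h, norm_mul, norm_inv, norm_div]
    simp only [Complex.norm_natCast]
    gcongr
    calc ‖z ^ N - 1‖ ≤ ‖z ^ N‖ + ‖(1 : ℂ)‖ := norm_sub_le _ _
      _ = 2 := by simp [hz]; norm_num

lemma tendsto_avg_star {ι B : Type*} [NormedRing B] [StarRing B]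
    [NormedAlgebra ℂ B] [StarModule ℂ B]
    (s : Finset ι) (u : ι → ℂ) (hu : ∀ i, ‖u i‖ = 1) (hinj : Set.InjOn u s) (w : ι → B) :
    Tendsto (fun N : ℕ => (N : ℂ)⁻¹ • ∑ n ∈ range N,
      star (∑ i ∈ s, u i ^ n • w i) * (∑ i ∈ s, u i ^ n • w i)) atTop
      (𝓝 (∑ i ∈ s, star (w i) * w i)) := by
  classical
  have key : ∀ N : ℕ, (N : ℂ)⁻¹ • ∑ n ∈ range N,
      star (∑ i ∈ s, u i ^ n • w i) * (∑ i ∈ s, u i ^ n • w i)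
      = ∑ i ∈ s, ∑ j ∈ s, ((N : ℂ)⁻¹ * ∑ n ∈ range N, (star (u i) * u j) ^ n) •
          (star (w i) * w j) := by
    intro N
    simp only [mul_smul, ← Finset.smul_sum]
    congr 1
    simp only [Finset.sum_smul]
    rw [Finset.sum_congr rfl (fun i _ => Finset.sum_comm), Finset.sum_comm]
    refine Finset.sum_congr rfl fun n _ => ?_
    rw [star_sum, Finset.sum_mul_sum]
    refine Finset.sum_congr rfl fun i _ => Finset.sum_congr rfl fun j _ => ?_
    rw [star_smul, smul_mul_smul_comm, mul_pow, star_pow]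
  simp only [key]
  have : ∑ i ∈ s, star (w i) * w i = ∑ i ∈ s, ∑ j ∈ s,
      (if star (u i) * u j = 1 then (1 : ℂ) else 0) • (star (w i) * w j) := by
    refine Finset.sum_congr rfl fun i hi => ?_
    rw [Finset.sum_eq_single_of_mem i hi]
    · have : star (u i) * u i = 1 := by
        have := Complex.conj_mul' (u i)
        rw [hu i] at this
        simpa using this
      rw [if_pos this, one_smul]
    · intro j hj hji
      rw [if_neg, zero_smul]
      intro h
      have h2 : u i * star (u i) = 1 := by
        have := Complex.mul_conj' (u i)
        rw [hu i] at this
        simpa using this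
      apply hji
      apply hinj hj hi
      calc u j = (u i * star (u i)) * u j := by rw [h2, one_mul]
        _ = u i * (star (u i) * u j) := by ring
        _ = u i := by rw [h, mul_one]
  rw [this]
  refine tendsto_finsetSum _ fun i _ => tendsto_finsetSum _ fun j _ => ?_
  refine (tendsto_avg _ ?_).smul_const _
  rw [norm_mul, norm_star, hu, hu, mul_one]

section weyl
variable {V : Type*} [AddCommGroup V] [Module ℝ V]
    (ω : V →ₗ[ℝ] V →ₗ[ℝ] ℝ)

lemma lower
    (hanti : ∀ φ ψ : V, ω φ ψ = - ω ψ φ)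
    (hnondeg : ∀ φ : V, (∀ ψ : V, ω φ ψ = 0) → φ = 0)
    (s : Finset V) (y : V → ℂ) (T : Finset V) (c : ℝ)
    (h : ∀ ψ : V, ∃ θ ∈ T, c ≤ ‖∑ φ ∈ s, chi ω (ψ + θ) φ * y φ‖ ^ 2) :
    c ≤ T.card * ∑ φ ∈ s, ‖y φ‖ ^ 2 := by
  obtain ⟨ψ, hψ⟩ := exists_sep ω hanti hnondeg s
  have ht : ∀ θ ∈ T, Tendsto (fun N : ℕ => (N : ℝ)⁻¹ * ∑ n ∈ range N,
      ‖∑ φ ∈ s, chi ω (n • ψ + θ) φ * y φ‖ ^ 2) atTop (𝓝 (∑ φ ∈ s, ‖y φ‖ ^ 2)) := by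
    intro θ _
    have h1 := tendsto_avg_star s (fun φ => chi ω ψ φ) (norm_chi ω ψ) hψ
      (fun φ => chi ω θ φ * y φ)
    have h2 := (Complex.continuous_re.tendsto _).comp h1
    have e1 : (∑ φ ∈ s, star (chi ω θ φ * y φ) * (chi ω θ φ * y φ)).re
        = ∑ φ ∈ s, ‖y φ‖ ^ 2 := by
      rw [Complex.re_sum]
      refine Finset.sum_congr rfl fun φ _ => ?_
      have := Complex.conj_mul' (chi ω θ φ * y φ)
      rw [norm_mul, norm_chi, one_mul] at this
      have h3 := congrArg Complex.re this
      rw [← Complex.ofReal_pow, Complex.ofReal_re] at h3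
      exact h3
    rw [e1] at h2
    refine h2.congr fun N => ?_
    simp only [Function.comp]
    rw [smul_eq_mul, show ((N : ℂ)⁻¹) = (((N : ℝ)⁻¹ : ℝ) : ℂ) by simp, Complex.re_ofReal_mul,
      Complex.re_sum]
    congr 1
    refine Finset.sum_congr rfl fun n _ => ?_
    have e2 : ∑ φ ∈ s, chi ω ψ φ ^ n • (chi ω θ φ * y φ)
        = ∑ φ ∈ s, chi ω (n • ψ + θ) φ * y φ := by
      refine Finset.sum_congr rfl fun φ _ => ?_
      rw [chi_add, chi_nsmul, smul_eq_mul, mul_assoc]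
    rw [e2]
    have h3 := congrArg Complex.re (Complex.conj_mul' (∑ φ ∈ s, chi ω (n • ψ + θ) φ * y φ))
    rw [← Complex.ofReal_pow, Complex.ofReal_re] at h3
    exact h3
  have hs := tendsto_finsetSum T ht
  simp only [Finset.sum_const, nsmul_eq_mul] at hs
  refine ge_of_tendsto hs ?_
  filter_upwards [eventually_gt_atTop 0] with N hN
  rw [← Finset.mul_sum, Finset.sum_comm]
  have hN' : (0 : ℝ) < N := by exact_mod_cast hN
  rw [le_inv_mul_iff₀ hN']
  calc (N : ℝ) * c = ∑ n ∈ range N, c := by simp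
    _ ≤ _ := by
      refine Finset.sum_le_sum fun n _ => ?_
      obtain ⟨θ, hθ, hc⟩ := h (n • ψ)
      exact hc.trans (Finset.single_le_sum
        (f := fun θ => ‖∑ φ ∈ s, chi ω (n • ψ + θ) φ * y φ‖ ^ 2)
        (fun _ _ => by positivity) hθ)

variable {A : Type*} [NormedRing A] [StarRing A] [CStarRing A]
    [NormedAlgebra ℂ A] [StarModule ℂ A]


lemma star_mul_W
    (hanti : ∀ φ ψ : V, ω φ ψ = - ω ψ φ)
    (W : V → A)
    (hW0 : W 0 = 1)
    (hWstar : ∀ φ : V, W (-φ) = star (W φ))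
    (hWmul : ∀ φ ψ : V,
      W φ * W ψ = Complex.exp (-(Complex.I * (ω φ ψ : ℂ)) / 2) • W (φ + ψ))
    (φ : V) : star (W φ) * W φ = 1 := by
  have : ω φ φ = 0 := by have := hanti φ φ; linarith
  rw [← hWstar, hWmul]
  simp [this, hW0]

lemma norm_W_le
    (hanti : ∀ φ ψ : V, ω φ ψ = - ω ψ φ)
    (W : V → A)
    (hW0 : W 0 = 1)
    (hWstar : ∀ φ : V, W (-φ) = star (W φ))
    (hWmul : ∀ φ ψ : V,
      W φ * W ψ = Complex.exp (-(Complex.I * (ω φ ψ : ℂ)) / 2) • W (φ + ψ))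
    (φ : V) : ‖W φ‖ ≤ 1 := by
  rcases subsingleton_or_nontrivial A with h | h
  · rw [Subsingleton.elim (W φ) 0]; simp
  have h1 := CStarRing.norm_star_mul_self (x := W φ)
  rw [star_mul_W ω hanti W hW0 hWstar hWmul, CStarRing.norm_one] at h1
  nlinarith [norm_nonneg (W φ)]

lemma conj_W
    (hanti : ∀ φ ψ : V, ω φ ψ = - ω ψ φ)
    (W : V → A)
    (hW0 : W 0 = 1)
    (hWstar : ∀ φ : V, W (-φ) = star (W φ))
    (hWmul : ∀ φ ψ : V,
      W φ * W ψ = Complex.exp (-(Complex.I * (ω φ ψ : ℂ)) / 2) • W (φ + ψ))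
    (ψ φ : V) : W ψ * W φ * star (W ψ) = chi ω ψ φ • W φ := by
  have h0 : ω ψ ψ = 0 := by have := hanti ψ ψ; linarith
  have h1 := hanti φ ψ
  rw [← hWstar, hWmul, smul_mul_assoc, hWmul, smul_smul, ← Complex.exp_add, chi]
  congr 2
  · simp [h0, h1]; ring
  · abel

lemma norm_conj_le
    (hanti : ∀ φ ψ : V, ω φ ψ = - ω ψ φ)
    (W : V → A)
    (hW0 : W 0 = 1)
    (hWstar : ∀ φ : V, W (-φ) = star (W φ))
    (hWmul : ∀ φ ψ : V,
      W φ * W ψ = Complex.exp (-(Complex.I * (ω φ ψ : ℂ)) / 2) • W (φ + ψ))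
    (ψ : V) (a : A) : ‖W ψ * a * star (W ψ)‖ ≤ ‖a‖ := by
  have h := norm_W_le ω hanti W hW0 hWstar hWmul ψ
  have h' : ‖star (W ψ)‖ ≤ 1 := by rwa [norm_star]
  calc ‖W ψ * a * star (W ψ)‖ ≤ ‖W ψ‖ * ‖a‖ * ‖star (W ψ)‖ :=
        (norm_mul_le _ _).trans (by gcongr; exact norm_mul_le _ _)
    _ ≤ 1 * ‖a‖ * 1 := by gcongr
    _ = ‖a‖ := by ring

lemma conj_sum
    (hanti : ∀ φ ψ : V, ω φ ψ = - ω ψ φ)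
    (W : V → A)
    (hW0 : W 0 = 1)
    (hWstar : ∀ φ : V, W (-φ) = star (W φ))
    (hWmul : ∀ φ ψ : V,
      W φ * W ψ = Complex.exp (-(Complex.I * (ω φ ψ : ℂ)) / 2) • W (φ + ψ))
    (ψ : V) (s : Finset V) (x : V → ℂ) :
    W ψ * (∑ φ ∈ s, x φ • W φ) * star (W ψ) = ∑ φ ∈ s, chi ω ψ φ • x φ • W φ := by
  rw [Finset.mul_sum, Finset.sum_mul]
  refine Finset.sum_congr rfl fun φ _ => ?_
  rw [mul_smul_comm, smul_mul_assoc, conj_W ω hanti W hW0 hWstar hWmul, smul_comm]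

lemma l2_le
    (hanti : ∀ φ ψ : V, ω φ ψ = - ω ψ φ)
    (hnondeg : ∀ φ : V, (∀ ψ : V, ω φ ψ = 0) → φ = 0)
    (W : V → A)
    (hW0 : W 0 = 1)
    (hWstar : ∀ φ : V, W (-φ) = star (W φ))
    (hWmul : ∀ φ ψ : V,
      W φ * W ψ = Complex.exp (-(Complex.I * (ω φ ψ : ℂ)) / 2) • W (φ + ψ))
    (h1 : (1 : A) ≠ 0) (s : Finset V) (x : V → ℂ) :
    ∑ φ ∈ s, ‖x φ‖ ^ 2 ≤ ‖∑ φ ∈ s, x φ • W φ‖ ^ 2 := by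
  have : Nontrivial A := ⟨1, 0, h1⟩
  obtain ⟨ψ, hψ⟩ := exists_sep ω hanti hnondeg s
  have ht := tendsto_avg_star s (fun φ => chi ω ψ φ) (norm_chi ω ψ) hψ (fun φ => x φ • W φ)
  have e : ∑ φ ∈ s, star (x φ • W φ) * (x φ • W φ)
      = ((∑ φ ∈ s, ‖x φ‖ ^ 2 : ℝ) : ℂ) • (1 : A) := by
    rw [Complex.ofReal_sum, Finset.sum_smul]
    refine Finset.sum_congr rfl fun φ _ => ?_
    rw [star_smul, smul_mul_smul_comm, star_mul_W ω hanti W hW0 hWstar hWmul]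
    congr 1
    have := Complex.conj_mul' (x φ)
    rw [Complex.ofReal_pow]
    exact this
  rw [e] at ht
  have ht2 := ht.norm
  rw [norm_smul, CStarRing.norm_one, mul_one, Complex.norm_real, Real.norm_of_nonneg
    (by positivity)] at ht2
  refine le_of_tendsto ht2 ?_
  filter_upwards [eventually_gt_atTop 0] with N hN
  have hN' : (0 : ℝ) < N := by exact_mod_cast hN
  rw [norm_smul, norm_inv, Complex.norm_natCast, inv_mul_le_iff₀ hN']
  calc _ ≤ ∑ n ∈ range N, ‖∑ φ ∈ s, x φ • W φ‖ ^ 2 := by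
        refine norm_sum_le_of_le _ fun n _ => ?_
        rw [CStarRing.norm_star_mul_self, ← sq]
        have h3 := conj_sum ω hanti W hW0 hWstar hWmul (n • ψ) s x
        simp only [chi_nsmul] at h3
        rw [← h3]
        gcongr
        exact norm_conj_le ω hanti W hW0 hWstar hWmul _ _
    _ = _ := by simp

/-- Finitely many translates of an almost-period set cover. -/
lemma syndetic
    (hanti : ∀ φ ψ : V, ω φ ψ = - ω ψ φ)
    (W : V → A)
    (hW0 : W 0 = 1)
    (hWstar : ∀ φ : V, W (-φ) = star (W φ))
    (hWmul : ∀ φ ψ : V,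
      W φ * W ψ = Complex.exp (-(Complex.I * (ω φ ψ : ℂ)) / 2) • W (φ + ψ))
    (s : Finset V) (x : V → ℂ) (δ : ℝ) (hδ : 0 < δ) :
    ∃ T : Finset V, ∀ ψ : V, ∃ θ ∈ T,
      ‖W (ψ + θ) * (∑ φ ∈ s, x φ • W φ) * star (W (ψ + θ)) - ∑ φ ∈ s, x φ • W φ‖ ≤ δ := by
  classical
  set M : ℝ := 1 + ∑ φ ∈ s, ‖x φ‖ with hM
  have hMpos : 0 < M := by positivity
  let g : V → (s → ℂ) := fun ψ φ => chi ω ψ φ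
  have htb : TotallyBounded (Set.range g) := by
    refine (isCompact_closedBall (0 : s → ℂ) 1).totallyBounded.subset ?_
    rintro _ ⟨ψ, rfl⟩
    rw [mem_closedBall_zero_iff, pi_norm_le_iff_of_nonneg zero_le_one]
    intro φ
    exact (norm_chi ω ψ φ).le
  obtain ⟨t, hts, htf, hcov⟩ := Metric.finite_approx_of_totallyBounded htb (δ / M) (by positivity)
  obtain ⟨T, hT, hTt⟩ : ∃ T : Finset V, True ∧ ∀ y ∈ t, ∃ θ ∈ T, g θ = y := by
    choose! p hp using fun y (hy : y ∈ t) => hts hy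
    exact ⟨htf.toFinset.image p, trivial, fun y hy =>
      ⟨p y, Finset.mem_image_of_mem _ (htf.mem_toFinset.mpr hy), hp y hy⟩⟩
  refine ⟨T.image (fun θ => -θ), fun ψ => ?_⟩
  have hmem := hcov ⟨ψ, rfl⟩
  simp only [Set.mem_iUnion] at hmem
  obtain ⟨y, hy, hd⟩ := hmem
  obtain ⟨θ, hθ, rfl⟩ := hTt y hy
  refine ⟨-θ, Finset.mem_image_of_mem _ hθ, ?_⟩
  rw [conj_sum ω hanti W hW0 hWstar hWmul, ← Finset.sum_sub_distrib]
  calc _ ≤ ∑ φ ∈ s, δ / M * ‖x φ‖ := by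
        refine norm_sum_le_of_le _ fun φ hφ => ?_
        have h1 : ‖chi ω ψ φ - chi ω θ φ‖ ≤ δ / M := by
          rw [← dist_eq_norm]
          exact (dist_le_pi_dist (g ψ) (g θ) ⟨φ, hφ⟩).trans (Metric.mem_ball.mp hd).le
        have h2 : ‖chi ω (ψ + -θ) φ - 1‖ ≤ δ / M := by
          have h3 : chi ω ψ φ = chi ω (ψ + -θ) φ * chi ω θ φ := by
            rw [← chi_add]; congr 1; abel
          have h4 : chi ω ψ φ - chi ω θ φ = (chi ω (ψ + -θ) φ - 1) * chi ω θ φ := by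
            rw [h3]; ring
          rwa [h4, norm_mul, norm_chi, mul_one] at h1
        have h5 : chi ω (ψ + -θ) φ • x φ • W φ - x φ • W φ
            = (chi ω (ψ + -θ) φ - 1) • x φ • W φ := by rw [sub_smul, one_smul]
        rw [h5, norm_smul, norm_smul]
        have h6 := norm_W_le ω hanti W hW0 hWstar hWmul φ
        calc _ ≤ δ / M * (‖x φ‖ * 1) := by gcongr
          _ = _ := by rw [mul_one]
    _ = δ / M * ∑ φ ∈ s, ‖x φ‖ := by rw [Finset.mul_sum]
    _ ≤ δ / M * M := by gcongr; linarith
    _ = δ := by field_simp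

lemma approx
    (hanti : ∀ φ ψ : V, ω φ ψ = - ω ψ φ)
    (W : V → A)
    (hW0 : W 0 = 1)
    (hWstar : ∀ φ : V, W (-φ) = star (W φ))
    (hWmul : ∀ φ ψ : V,
      W φ * W ψ = Complex.exp (-(Complex.I * (ω φ ψ : ℂ)) / 2) • W (φ + ψ))
    (hgen : (StarAlgebra.adjoin ℂ (Set.range W)).topologicalClosure = ⊤)
    (a : A) (ε : ℝ) (hε : 0 < ε) :
    ∃ (s : Finset V) (x : V → ℂ), ‖a - ∑ φ ∈ s, x φ • W φ‖ < ε := by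
  have hsub : ∀ y ∈ StarAlgebra.adjoin ℂ (Set.range W), y ∈ Submodule.span ℂ (Set.range W) := by
    intro y hy
    induction hy using StarAlgebra.adjoin_induction with
    | mem y h => exact Submodule.subset_span h
    | algebraMap r =>
      rw [Algebra.algebraMap_eq_smul_one, ← hW0]
      exact Submodule.smul_mem _ _ (Submodule.subset_span ⟨0, rfl⟩)
    | add y z _ _ h1 h2 => exact add_mem h1 h2
    | mul y z _ _ h1 h2 =>
      have h3 := Submodule.mul_mem_mul h1 h2
      rw [Submodule.span_mul_span] at h3
      refine Submodule.span_le.mpr ?_ h3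
      rintro _ ⟨_, ⟨φ, rfl⟩, _, ⟨ψ, rfl⟩, rfl⟩
      simp only [hWmul]
      exact Submodule.smul_mem _ _ (Submodule.subset_span ⟨_, rfl⟩)
    | star y hy h1 =>
      clear hy
      induction h1 using Submodule.span_induction with
      | mem y h =>
        obtain ⟨φ, rfl⟩ := h
        rw [← hWstar]
        exact Submodule.subset_span ⟨_, rfl⟩
      | zero => simp
      | add y z _ _ h1 h2 => rw [star_add]; exact add_mem h1 h2
      | smul c y _ h => rw [star_smul]; exact Submodule.smul_mem _ _ h
  have ha : a ∈ closure ((StarAlgebra.adjoin ℂ (Set.range W) : StarSubalgebra ℂ A) : Set A) := by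
    rw [← StarSubalgebra.topologicalClosure_coe, hgen]; trivial
  obtain ⟨y, hy, hd⟩ := Metric.mem_closure_iff.mp ha ε hε
  obtain ⟨c, rfl⟩ := Finsupp.mem_span_range_iff_exists_finsupp.mp (hsub y hy)
  exact ⟨c.support, c, by rw [← dist_eq_norm]; exact hd⟩
end weyl

end CCRaux

open CCRaux


/-- Let `(V, ω)` be a symplectic vector space and `(A, W)` a
CCR-representation of `(V, ω)`.  Let `B` be a unital C*-algebra in which `1 ≠ 0`
and let `π : A → B` be a unit-preserving *-homomorphism.  Then `π` is injective. -/
theorem ccr_star_hom_injective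
    {V : Type*} [AddCommGroup V] [Module ℝ V]
    (ω : V →ₗ[ℝ] V →ₗ[ℝ] ℝ)
    (hanti : ∀ φ ψ : V, ω φ ψ = - ω ψ φ)
    (hnondeg : ∀ φ : V, (∀ ψ : V, ω φ ψ = 0) → φ = 0)
    {A : Type*} [NormedRing A] [StarRing A] [CStarRing A]
    [NormedAlgebra ℂ A] [StarModule ℂ A] [CompleteSpace A]
    (W : V → A)
    (hW0 : W 0 = 1)
    (hWstar : ∀ φ : V, W (-φ) = star (W φ))
    (hWmul : ∀ φ ψ : V,
      W φ * W ψ = Complex.exp (-(Complex.I * (ω φ ψ : ℂ)) / 2) • W (φ + ψ))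
    (hgen : (StarAlgebra.adjoin ℂ (Set.range W)).topologicalClosure = ⊤)
    {B : Type*} [NormedRing B] [StarRing B] [CStarRing B]
    [NormedAlgebra ℂ B] [StarModule ℂ B] [CompleteSpace B]
    (hB : (1 : B) ≠ 0)
    (π : A →⋆ₐ[ℂ] B) :
    Function.Injective π := by
  
  rw [injective_iff_map_eq_zero]
  intro a ha
  by_contra hne
  have hcontr : ∀ z : A, ‖π z‖ ≤ ‖z‖ := by
    intro z
    let _ : CStarAlgebra A := { }
    let _ : CStarAlgebra B := { }
    exact NonUnitalStarAlgHom.norm_apply_le π z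
  have hr : 0 < ‖a‖ := norm_pos_iff.mpr hne
  obtain ⟨f, hf1, hfa⟩ := exists_dual_vector'' ℂ a
  set r := ‖a‖ with hrdef
  have hfle : ∀ z : A, ‖f z‖ ≤ ‖z‖ := fun z =>
    (f.le_opNorm z).trans (mul_le_of_le_one_left (norm_nonneg _) hf1)
  obtain ⟨s₀, x₀, h₀⟩ := approx ω hanti W hW0 hWstar hWmul hgen a (r / 10) (by positivity)
  obtain ⟨T, hT⟩ := syndetic ω hanti W hW0 hWstar hWmul s₀ x₀ (r / 10) (by positivity)
  set a₀ := ∑ φ ∈ s₀, x₀ φ • W φ with ha₀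
  obtain ⟨k, hk, hc⟩ : ∃ k : ℝ, (T.card : ℝ) = k ∧ 0 ≤ k := ⟨_, rfl, Nat.cast_nonneg _⟩
  -- the main estimate
  have main : ∀ ε : ℝ, 0 < ε → ε ≤ r / 10 → (r / 2) ^ 2 ≤ k * ε ^ 2 := by
    intro ε hε hεr
    obtain ⟨s, x, hx⟩ := approx ω hanti W hW0 hWstar hWmul hgen a ε hε
    have hlow := lower ω hanti hnondeg s (fun φ => x φ * f (W φ)) T ((r / 2) ^ 2) (by
      intro ψ
      obtain ⟨θ, hθ, hθ2⟩ := hT ψ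
      refine ⟨θ, hθ, ?_⟩
      set y := ∑ φ ∈ s, x φ • W φ with hy
      have e : ∑ φ ∈ s, chi ω (ψ + θ) φ * (x φ * f (W φ))
          = f (W (ψ + θ) * y * star (W (ψ + θ))) := by
        rw [hy, conj_sum ω hanti W hW0 hWstar hWmul, map_sum]
        refine Finset.sum_congr rfl fun φ _ => ?_
        simp
      rw [e]
      set U := W (ψ + θ) with hU
      have c1 : ‖U * (y - a₀) * star U‖ ≤ ‖y - a₀‖ :=
        norm_conj_le ω hanti W hW0 hWstar hWmul _ _
      have c2 : ‖y - a₀‖ ≤ ‖a - a₀‖ + ‖a - y‖ := by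
        have : y - a₀ = (a - a₀) - (a - y) := by abel
        rw [this]; exact norm_sub_le _ _
      have c3 : ‖a - U * y * star U‖ ≤ ‖a - a₀‖ + ‖U * a₀ * star U - a₀‖
          + ‖U * (y - a₀) * star U‖ := by
        have : a - U * y * star U = (a - a₀) - (U * a₀ * star U - a₀)
          - U * (y - a₀) * star U := by
          rw [mul_sub, sub_mul]; abel
        rw [this]
        refine (norm_sub_le _ _).trans ?_
        gcongr
        exact norm_sub_le _ _
      have c4 : ‖f a‖ ≤ ‖f (U * y * star U)‖ + ‖a - U * y * star U‖ := by
        have : f a = f (U * y * star U) + f (a - U * y * star U) := by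
          rw [← map_add]; congr 1; abel
        rw [this]
        refine (norm_add_le _ _).trans ?_
        gcongr
        exact hfle _
      have c5 : ‖f a‖ = r := by rw [hfa]; simp [hrdef]
      have c6 : r / 2 ≤ ‖f (U * y * star U)‖ := by linarith
      gcongr)
    have hup := l2_le ω hanti hnondeg (fun φ => π (W φ)) (by simp [hW0])
      (fun φ => by simp [hWstar, map_star]) (fun φ ψ => by rw [← map_mul, hWmul, map_smul]) hB s x
    have e2 : ∑ φ ∈ s, x φ • π (W φ) = π (∑ φ ∈ s, x φ • W φ) := by
      rw [map_sum]
      exact Finset.sum_congr rfl fun φ _ => (map_smul π _ _).symm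
    have e3 : ‖π (∑ φ ∈ s, x φ • W φ)‖ ≤ ε := by
      have : π (∑ φ ∈ s, x φ • W φ) = - π (a - ∑ φ ∈ s, x φ • W φ) := by
        rw [map_sub, ha]; abel
      rw [this, norm_neg]
      exact (hcontr _).trans hx.le
    rw [e2] at hup
    have hup2 : ∑ φ ∈ s, ‖x φ‖ ^ 2 ≤ ε ^ 2 := hup.trans (by gcongr)
    rw [hk] at hlow
    refine hlow.trans ?_
    gcongr
    refine le_trans (Finset.sum_le_sum fun φ _ => ?_) hup2
    rw [norm_mul]
    have h7 : ‖f (W φ)‖ ≤ 1 := (hfle _).trans (norm_W_le ω hanti W hW0 hWstar hWmul φ)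
    gcongr
    exact mul_le_of_le_one_right (norm_nonneg _) h7
  set K : ℝ := 10 + k with hK
  have hKpos : 0 < K := by positivity
  have h := main (r / K) (by positivity) (by gcongr; linarith)
  rw [div_pow, div_pow, mul_div_assoc', div_le_div_iff₀ (by positivity) (by positivity)] at h
  have hr2 : 0 < r ^ 2 := by positivity
  have h8 : K ^ 2 ≤ k * 2 ^ 2 := by
    refine le_of_mul_le_mul_left ?_ hr2
    linarith
  rw [hK] at h8
  nlinarith
end

section
/- Let n ≥ 2 and let φ : ℝⁿ → ℂ be a smooth compactly supported function. Then the map α ↦ ∫_{ℝⁿ} R₊(α)(x)·φ(x) dx is holomorphic on the half-plane {α ∈ ℂ : Re(α) > n}. -/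
open MeasureTheory

/-- The first coordinate `x₁` of a vector `x ∈ ℝⁿ`. -/
def firstCoord {n : ℕ} (x : Fin n → ℝ) : ℝ :=
  if h : 0 < n then x ⟨0, h⟩ else 0

/-- The Minkowski quadratic form `γ(x) = x₁² − x₂² − ⋯ − xₙ²` on `ℝⁿ`. -/
def minkGamma {n : ℕ} (x : Fin n → ℝ) : ℝ :=
  2 * firstCoord x ^ 2 - ∑ i, x i ^ 2

/-- Membership in the causal future of the origin:
`J₊(0) = {x ∈ ℝⁿ : γ(x) ≥ 0 and x₁ ≥ 0}`. -/
def inCausalFuture {n : ℕ} (x : Fin n → ℝ) : Prop :=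
  0 ≤ minkGamma x ∧ 0 ≤ firstCoord x


noncomputable instance {n : ℕ} (x : Fin n → ℝ) : Decidable (inCausalFuture x) :=
  inferInstanceAs (Decidable (0 ≤ minkGamma x ∧ 0 ≤ firstCoord x))

/-- The coefficient `C(α, n) = 2^{1−α} π^{(2−n)/2} / (Γ(α/2) Γ((α−n+2)/2))`. -/
noncomputable def rieszCoeff (α : ℂ) (n : ℕ) : ℂ :=
  (2 : ℂ) ^ ((1 : ℂ) - α) * (Real.pi : ℂ) ^ (((2 : ℂ) - (n : ℂ)) / 2) /
    (Complex.Gamma (α / 2) * Complex.Gamma ((α - (n : ℂ) + 2) / 2))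

/-- The advanced Riesz distribution `R₊(α)` on `ℝⁿ`; for `Re α > n` this is the
continuous function `R₊(α)(x) = C(α,n) γ(x)^{(α−n)/2}` on `J₊(0)` and `0` elsewhere. -/
noncomputable def rieszPlus (n : ℕ) (α : ℂ) (x : Fin n → ℝ) : ℂ :=
  if inCausalFuture x then
    rieszCoeff α n * (minkGamma x : ℂ) ^ ((α - (n : ℂ)) / 2)
  else 0

open Topology

lemma firstCoord_cont {n : ℕ} : Continuous (firstCoord (n := n)) := by
  unfold firstCoord
  by_cases h : 0 < n
  · simp only [h, dif_pos]; fun_prop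
  · simp only [h, dif_neg, not_false_eq_true]; fun_prop

lemma minkGamma_cont {n : ℕ} : Continuous (minkGamma (n := n)) := by
  unfold minkGamma
  have := firstCoord_cont (n := n)
  fun_prop

lemma causal_meas {n : ℕ} : MeasurableSet {x : Fin n → ℝ | inCausalFuture x} := by
  unfold inCausalFuture
  exact ((isClosed_le continuous_const minkGamma_cont).inter
    (isClosed_le continuous_const firstCoord_cont)).measurableSet

lemma cpow_log_bound {t a b : ℝ} (ht : 0 ≤ t) (ha : 0 < a) {s : ℂ} (has : a ≤ s.re)
    (hsb : s.re ≤ b) : ‖(t : ℂ) ^ s * Complex.log t‖ ≤ 1 / a + t ^ (b + 1) := by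
  have hs : s.re ≠ 0 := by linarith
  rw [norm_mul, Complex.norm_cpow_eq_rpow_re_of_nonneg ht hs, ← Complex.ofReal_log ht,
    Complex.norm_real, Real.norm_eq_abs]
  have h0 : 0 ≤ t ^ (b + 1) := Real.rpow_nonneg ht _
  rcases ht.eq_or_lt with rfl | htp
  · simp; positivity
  rcases le_total t 1 with h1 | h1
  · have h2 := Real.abs_log_mul_self_rpow_lt t a htp h1 ha
    rw [abs_mul, abs_of_nonneg (Real.rpow_nonneg ht a)] at h2
    have h3 : t ^ s.re ≤ t ^ a := Real.rpow_le_rpow_of_exponent_ge htp h1 has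
    have h4 := mul_le_mul_of_nonneg_right h3 (abs_nonneg (Real.log t))
    linarith
  · have h2 : |Real.log t| ≤ t := by
      rw [abs_of_nonneg (Real.log_nonneg h1)]
      linarith [Real.log_le_sub_one_of_pos htp]
    have h3 : t ^ s.re ≤ t ^ b := Real.rpow_le_rpow_of_exponent_le h1 hsb
    have h4 := mul_le_mul h3 h2 (abs_nonneg _) (Real.rpow_nonneg ht _)
    rw [Real.rpow_add htp, Real.rpow_one]
    have : 0 < 1 / a := by positivity
    rw [Real.rpow_add htp, Real.rpow_one] at h0
    linarith

lemma hasDerivAt_cpow_exp {t : ℝ} {s : ℂ} (hs : 0 < s.re) :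
    HasDerivAt (fun s : ℂ => (t : ℂ) ^ s) ((t : ℂ) ^ s * Complex.log t) s := by
  have hne : s ≠ 0 := by rintro rfl; simp at hs
  simpa using (hasDerivAt_id s).const_cpow (c := (t : ℂ)) (Or.inr hne)

lemma meas_aux {n : ℕ} {φ : (Fin n → ℝ) → ℂ} (hφ : Continuous φ) (s : ℂ) :
    Measurable (fun x : Fin n → ℝ => if inCausalFuture x then
      (minkGamma x : ℂ) ^ s * φ x else 0) := by
  have hm : Measurable (fun x : Fin n → ℝ => (minkGamma x : ℂ)) :=
    (Complex.continuous_ofReal.comp minkGamma_cont).measurable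
  exact Measurable.ite causal_meas ((hm.pow_const s).mul hφ.measurable) measurable_const

lemma meas_aux2 {n : ℕ} {φ : (Fin n → ℝ) → ℂ} (hφ : Continuous φ) (s : ℂ) :
    Measurable (fun x : Fin n → ℝ => if inCausalFuture x then
      (minkGamma x : ℂ) ^ s * Complex.log (minkGamma x) * φ x else 0) := by
  have hm : Measurable (fun x : Fin n → ℝ => (minkGamma x : ℂ)) :=
    (Complex.continuous_ofReal.comp minkGamma_cont).measurable
  exact Measurable.ite causal_meas (((hm.pow_const s).mul hm.clog).mul hφ.measurable)
    measurable_const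

lemma riesz_int_diff {n : ℕ} {φ : (Fin n → ℝ) → ℂ} (hφ : Continuous φ)
    (hφc : HasCompactSupport φ) {s₀ : ℂ} (hs₀ : 0 < s₀.re) :
    DifferentiableAt ℂ (fun s : ℂ => ∫ x : Fin n → ℝ, if inCausalFuture x then
      (minkGamma x : ℂ) ^ s * φ x else 0) s₀ := by
  have hγ := minkGamma_cont (n := n)
  set S : Set ℂ := {s | s₀.re / 2 < s.re ∧ s.re < s₀.re + 1} with hS
  have hSo : S ∈ 𝓝 s₀ := by
    apply IsOpen.mem_nhds
    · exact (isOpen_lt continuous_const Complex.continuous_re).inter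
        (isOpen_lt Complex.continuous_re continuous_const)
    · constructor <;> linarith
  have hpow : ∀ r : ℝ, 0 ≤ r → Continuous (fun x : Fin n → ℝ => |minkGamma x| ^ r) :=
    fun r hr => hγ.abs.rpow_const (fun _ => Or.inr hr)
  refine (hasDerivAt_integral_of_dominated_loc_of_deriv_le (μ := volume) (s := S)
    (F := fun s x => if inCausalFuture x then (minkGamma x : ℂ) ^ s * φ x else 0)
    (F' := fun s x => if inCausalFuture x then
      (minkGamma x : ℂ) ^ s * Complex.log (minkGamma x) * φ x else 0)
    (bound := fun x => (1 / (s₀.re / 2) + |minkGamma x| ^ (s₀.re + 1 + 1)) * ‖φ x‖)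
    hSo ?_ ?_ ?_ ?_ ?_ ?_).2.differentiableAt
  · exact Filter.Eventually.of_forall fun s => (meas_aux hφ s).aestronglyMeasurable
  · have hb : Integrable (fun x : Fin n → ℝ => |minkGamma x| ^ s₀.re * ‖φ x‖) :=
      ((hpow _ hs₀.le).mul hφ.norm).integrable_of_hasCompactSupport hφc.norm.mul_left
    refine hb.mono' (meas_aux hφ s₀).aestronglyMeasurable (Filter.Eventually.of_forall fun x => ?_)
    by_cases hx : inCausalFuture x
    · simp only [hx, if_true]
      rw [norm_mul, Complex.norm_cpow_eq_rpow_re_of_nonneg hx.1 hs₀.ne', abs_of_nonneg hx.1]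
    · simp only [hx, if_false, norm_zero]
      positivity
  · exact (meas_aux2 hφ s₀).aestronglyMeasurable
  · refine Filter.Eventually.of_forall fun x s hs => ?_
    by_cases hx : inCausalFuture x
    · simp only [hx, if_true]
      rw [norm_mul, abs_of_nonneg hx.1]
      exact mul_le_mul_of_nonneg_right
        (cpow_log_bound hx.1 (by linarith) hs.1.le hs.2.le) (norm_nonneg _)
    · simp only [hx, if_false, norm_zero]
      positivity
  · exact ((continuous_const.add (hpow _ (by linarith))).mul
      hφ.norm).integrable_of_hasCompactSupport hφc.norm.mul_left
  · refine Filter.Eventually.of_forall fun x s hs => ?_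
    by_cases hx : inCausalFuture x
    · simp only [hx, if_true]
      exact (hasDerivAt_cpow_exp (by linarith [hs.1])).mul_const _
    · simp only [hx, if_false]
      exact hasDerivAt_const _ _

lemma rieszCoeff_diff (n : ℕ) : Differentiable ℂ (fun α => rieszCoeff α n) := by
  unfold rieszCoeff
  simp only [div_eq_mul_inv _ (Complex.Gamma _ * Complex.Gamma _), mul_inv]
  have h1 : Differentiable ℂ (fun α : ℂ => (Complex.Gamma (α / 2))⁻¹) :=
    Complex.differentiable_one_div_Gamma.comp (f := fun α : ℂ => α / 2) (by fun_prop)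
  have h2 : Differentiable ℂ (fun α : ℂ => (Complex.Gamma ((α - (n : ℂ) + 2) / 2))⁻¹) :=
    Complex.differentiable_one_div_Gamma.comp
      (f := fun α : ℂ => (α - (n : ℂ) + 2) / 2) (by fun_prop)
  have h3 : Differentiable ℂ (fun α : ℂ => (2 : ℂ) ^ ((1 : ℂ) - α)) := fun α =>
    DifferentiableAt.const_cpow (by fun_prop) (Or.inl two_ne_zero)
  exact (h3.mul_const _).mul (h1.mul h2)

/-- Let `n ≥ 2` and let `φ : ℝⁿ → ℂ` be a smooth compactly
supported function.  Then the map `α ↦ ∫_{ℝⁿ} R₊(α)(x) φ(x) dx` is holomorphic on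
the half-plane `{α ∈ ℂ : Re α > n}`. -/
theorem riesz_plus_holomorphic_in_alpha
    (n : ℕ) (hn : 2 ≤ n) (φ : (Fin n → ℝ) → ℂ)
    (hφ : ContDiff ℝ (⊤ : ℕ∞) φ) (hφc : HasCompactSupport φ) :
    DifferentiableOn ℂ (fun α : ℂ => ∫ x : Fin n → ℝ, rieszPlus n α x * φ x)
      {α : ℂ | (n : ℝ) < α.re} := by
  intro α hα
  have hα' : (n : ℝ) < α.re := hα
  apply DifferentiableAt.differentiableWithinAt
  have heq : (fun α : ℂ => ∫ x : Fin n → ℝ, rieszPlus n α x * φ x) = fun α =>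
      rieszCoeff α n * ∫ x : Fin n → ℝ, if inCausalFuture x then
        (minkGamma x : ℂ) ^ ((α - (n : ℂ)) / 2) * φ x else 0 := by
    funext α
    rw [← integral_const_mul]
    congr 1
    funext x
    unfold rieszPlus
    split_ifs <;> ring
  rw [heq]
  have hre : 0 < ((α - (n : ℂ)) / 2).re := by
    have : ((α - (n : ℂ)) / 2).re = (α.re - n) / 2 := by
      simp
    rw [this]; linarith
  refine (rieszCoeff_diff n α).mul ?_
  exact (riesz_int_diff hφ.continuous hφc hre).comp (f := fun α : ℂ => (α - (n : ℂ)) / 2) α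
    (by fun_prop)
end

section
/- Let n ≥ 2 and let α ∈ ℂ with Re(α) > n. Then for every continuous compactly supported function f : ℝ → ℂ one has ∫_{ℝⁿ} R₊(α)(x)·f(x₁) dx = (1/Γ(α)) · ∫₀^∞ r^{α−1} f(r) dr, where x₁ denotes the first coordinate of x ∈ ℝⁿ. -/
open MeasureTheory

lemma riesz_radial (m : ℕ) (hm : 1 ≤ m) (s : ℂ) (t : ℝ) (ht : 0 < t) :
    ∫ r in Set.Ioi (0 : ℝ), r ^ (m - 1) •
      (if r ^ 2 ≤ t ^ 2 then (((t ^ 2 - r ^ 2 : ℝ) : ℂ)) ^ s else 0) =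
    (1 / 2 : ℂ) * (((t ^ 2 : ℝ) : ℂ) ^ ((m : ℂ) / 2 + s) *
      Complex.betaIntegral ((m : ℂ) / 2) (s + 1)) := by
  have h2 : (0 : ℝ) < t ^ 2 := by positivity
  have hb := Complex.betaIntegral_scaled ((m : ℂ) / 2) (s + 1) h2
  rw [show (m : ℂ) / 2 + (s + 1) - 1 = (m : ℂ) / 2 + s by ring] at hb
  rw [← hb, intervalIntegral.integral_of_le h2.le]
  set g : ℝ → ℂ := fun u => (u : ℂ) ^ ((m : ℂ) / 2 - 1) *
    (((t ^ 2 : ℝ) : ℂ) - u) ^ (s + 1 - 1) with hg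
  have hInd : ∫ u in Set.Ioc 0 (t ^ 2), g u =
      ∫ u in Set.Ioi (0 : ℝ), (Set.Iic (t ^ 2)).indicator g u := by
    rw [setIntegral_indicator measurableSet_Iic, Set.Ioi_inter_Iic]
  rw [hInd, ← integral_comp_rpow_Ioi_of_pos (g := (Set.Iic (t ^ 2)).indicator g) (p := 2) (by norm_num), ← integral_const_mul]
  refine setIntegral_congr_fun measurableSet_Ioi fun r hr => ?_
  have hr : 0 < r := hr
  have hrc : (r : ℂ) ≠ 0 := by exact_mod_cast hr.ne'
  simp only [Real.rpow_two, show (2 : ℝ) - 1 = 1 by norm_num, Real.rpow_one]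
  by_cases h : r ^ 2 ≤ t ^ 2
  · rw [if_pos h, Set.indicator_of_mem (show r ^ 2 ∈ Set.Iic (t ^ 2) from h), hg]
    simp only [Complex.real_smul]
    have e1 : ((r ^ 2 : ℝ) : ℂ) ^ ((m : ℂ) / 2 - 1) * r = (r : ℂ) ^ (m - 1) := by
      have : ((r ^ 2 : ℝ) : ℂ) ^ ((m : ℂ) / 2 - 1) = (r : ℂ) ^ ((m : ℂ) - 2) := by
        rw [show r ^ 2 = r * r by ring, Complex.ofReal_mul,
          Complex.mul_cpow_ofReal_nonneg hr.le hr.le, ← Complex.cpow_add _ _ hrc]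
        congr 1; ring
      rw [this]
      nth_rewrite 2 [← Complex.cpow_one (r : ℂ)]
      rw [← Complex.cpow_add _ _ hrc, ← Complex.cpow_natCast, Nat.cast_sub hm]
      congr 1; push_cast; ring
    rw [show s + 1 - 1 = s by ring, Complex.ofReal_pow r (m - 1), ← e1]
    push_cast
    ring
  · rw [if_neg h, Set.indicator_of_notMem (show r ^ 2 ∉ Set.Iic (t ^ 2) from h)]
    simp

lemma riesz_inner (m : ℕ) (hm : 1 ≤ m) (s : ℂ) (hs : 0 < s.re) (t : ℝ) (ht : 0 < t) :
    ∫ y : Fin m → ℝ, (if ∑ i, y i ^ 2 ≤ t ^ 2 then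
      (((t ^ 2 - ∑ i, y i ^ 2 : ℝ) : ℂ)) ^ s else 0) =
    (Real.pi : ℂ) ^ ((m : ℂ) / 2) * Complex.Gamma (s + 1) / Complex.Gamma ((m : ℂ) / 2 + s + 1) *
      ((t ^ 2 : ℝ) : ℂ) ^ ((m : ℂ) / 2 + s) := by
  have : Nonempty (Fin m) := ⟨⟨0, hm⟩⟩
  have hmp : 0 < (m : ℝ) := by exact_mod_cast hm
  have h1 := (EuclideanSpace.volume_preserving_symm_measurableEquiv_toLp (Fin m)).integral_comp'
    (fun y : Fin m → ℝ => (if ∑ i, y i ^ 2 ≤ t ^ 2 then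
      (((t ^ 2 - ∑ i, y i ^ 2 : ℝ) : ℂ)) ^ s else 0))
  rw [← h1]
  have h2 : ∀ x : EuclideanSpace ℝ (Fin m),
      ∑ i, ((MeasurableEquiv.toLp 2 (Fin m → ℝ)).symm x) i ^ 2 = ‖x‖ ^ 2 := by
    intro x
    rw [EuclideanSpace.real_norm_sq_eq]
    rfl
  simp only [h2]
  rw [integral_fun_norm_addHaar volume
    (fun r => if r ^ 2 ≤ t ^ 2 then (((t ^ 2 - r ^ 2 : ℝ) : ℂ)) ^ s else 0)]
  simp only [finrank_euclideanSpace, Fintype.card_fin]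
  rw [riesz_radial m hm s t ht]
  have hG : Complex.Gamma ((m : ℂ) / 2 + s + 1) ≠ 0 := by
    apply Complex.Gamma_ne_zero_of_re_pos
    have : ((m : ℂ) / 2).re = (m : ℝ) / 2 := by simp
    rw [Complex.add_re, Complex.add_re, this, Complex.one_re]; positivity
  have hGm : Complex.Gamma ((m : ℂ) / 2) ≠ 0 := by
    apply Complex.Gamma_ne_zero_of_re_pos
    have : ((m : ℂ) / 2).re = (m : ℝ) / 2 := by simp
    rw [this]; positivity
  have hB := Complex.Gamma_mul_Gamma_eq_betaIntegral (s := (m : ℂ) / 2) (t := s + 1)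
    (by have : ((m : ℂ) / 2).re = (m : ℝ) / 2 := by simp
        rw [this]; positivity)
    (by rw [Complex.add_re, Complex.one_re]; positivity)
  rw [← add_assoc] at hB
  have hV : (volume.real (Metric.ball (0 : EuclideanSpace ℝ (Fin m)) 1) : ℂ) =
      (Real.pi : ℂ) ^ ((m : ℂ) / 2) / ((m : ℂ) / 2 * Complex.Gamma ((m : ℂ) / 2)) := by
    rw [measureReal_def, EuclideanSpace.volume_ball]
    simp only [Fintype.card_fin, ENNReal.ofReal_one, one_pow, one_mul]
    have hGr : 0 < Real.Gamma ((m : ℝ) / 2 + 1) := Real.Gamma_pos_of_pos (by positivity)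
    rw [ENNReal.toReal_ofReal (by positivity), Complex.ofReal_div, ← Complex.Gamma_ofReal]
    congr 1
    · rw [Real.sqrt_eq_rpow, ← Real.rpow_natCast, ← Real.rpow_mul Real.pi_pos.le,
        Complex.ofReal_cpow Real.pi_pos.le]
      congr 1; push_cast; ring
    · push_cast
      rw [Complex.Gamma_add_one]
      have : (m : ℂ) ≠ 0 := by exact_mod_cast hmp.ne'
      simpa using this
  have hm0 : (m : ℂ) ≠ 0 := by exact_mod_cast hmp.ne'
  have hBe : Complex.betaIntegral ((m : ℂ) / 2) (s + 1) =
    Complex.Gamma ((m : ℂ) / 2) * Complex.Gamma (s + 1) / Complex.Gamma ((m : ℂ) / 2 + s + 1) := by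
    rw [hB, mul_div_cancel_left₀ _ hG]
  rw [nsmul_eq_mul, Complex.real_smul, hV, hBe]
  field_simp

lemma riesz_const (m : ℕ) (α : ℂ) (hα : ((m + 1 : ℕ) : ℝ) < α.re) :
    rieszCoeff α (m + 1) * ((Real.pi : ℂ) ^ ((m : ℂ) / 2) *
      Complex.Gamma ((α - ((m + 1 : ℕ) : ℂ)) / 2 + 1) /
      Complex.Gamma ((m : ℂ) / 2 + (α - ((m + 1 : ℕ) : ℂ)) / 2 + 1)) = 1 / Complex.Gamma α := by
  have hα0 : 0 < α.re := lt_of_le_of_lt (by positivity) hα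
  have hpi : (Real.pi : ℂ) ≠ 0 := by exact_mod_cast Real.pi_ne_zero
  have hre : ((α - ((m + 1 : ℕ) : ℂ)) / 2 + 1).re = (α.re - ((m + 1 : ℕ) : ℝ)) / 2 + 1 := by
    have : ((α - ((m + 1 : ℕ) : ℂ)) / 2) = (((1 / 2 : ℝ)) : ℂ) * (α - (((m + 1 : ℕ) : ℝ) : ℂ)) := by
      push_cast; ring
    rw [Complex.add_re, this, Complex.re_ofReal_mul, Complex.sub_re, Complex.ofReal_re,
      Complex.one_re]
    ring
  have hG1 : Complex.Gamma ((α - ((m + 1 : ℕ) : ℂ)) / 2 + 1) ≠ 0 := by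
    apply Complex.Gamma_ne_zero_of_re_pos
    rw [hre]; linarith
  have hGα : Complex.Gamma α ≠ 0 := Complex.Gamma_ne_zero_of_re_pos hα0
  have hD := Complex.Gamma_mul_Gamma_add_half (α / 2)
  rw [show 2 * (α / 2) = α by ring] at hD
  unfold rieszCoeff
  rw [show (α - ((m + 1 : ℕ) : ℂ) + 2) / 2 = (α - ((m + 1 : ℕ) : ℂ)) / 2 + 1 by ring,
    show (m : ℂ) / 2 + (α - ((m + 1 : ℕ) : ℂ)) / 2 + 1 = α / 2 + 1 / 2 by push_cast; ring]
  have h2 : (2 : ℂ) ^ (1 - α) ≠ 0 := by simp [Complex.cpow_eq_zero_iff]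
  have hsq : ((√Real.pi : ℝ) : ℂ) ≠ 0 := by
    exact_mod_cast (Real.sqrt_pos.mpr Real.pi_pos).ne'
  have hp : (Real.pi : ℂ) ^ ((2 - ((m + 1 : ℕ) : ℂ)) / 2) * (Real.pi : ℂ) ^ ((m : ℂ) / 2) =
      ((√Real.pi : ℝ) : ℂ) := by
    rw [← Complex.cpow_add _ _ hpi, Real.sqrt_eq_rpow, Complex.ofReal_cpow Real.pi_pos.le]
    congr 1; push_cast; ring
  have hne : Complex.Gamma (α / 2) * Complex.Gamma (α / 2 + 1 / 2) ≠ 0 := by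
    rw [hD]; exact mul_ne_zero (mul_ne_zero hGα h2) hsq
  have hA := left_ne_zero_of_mul hne
  have hB := right_ne_zero_of_mul hne
  generalize Complex.Gamma ((α - ((m + 1 : ℕ) : ℂ)) / 2 + 1) = G1 at *
  generalize Complex.Gamma (α / 2) = A at *
  generalize Complex.Gamma (α / 2 + 1 / 2) = B at *
  generalize (Real.pi : ℂ) ^ ((2 - ((m + 1 : ℕ) : ℂ)) / 2) = P at *
  generalize (Real.pi : ℂ) ^ ((m : ℂ) / 2) = Q at *
  generalize (2 : ℂ) ^ (1 - α) = T at *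
  field_simp
  linear_combination T * Complex.Gamma α * hp - hD

lemma riesz_integrable (m : ℕ) (α : ℂ) (hα : ((m + 1 : ℕ) : ℝ) < α.re)
    (f : ℝ → ℂ) (hf : Continuous f) (hfc : HasCompactSupport f) :
    Integrable (fun x : Fin (m + 1) → ℝ => rieszPlus (m + 1) α x * f (firstCoord x)) := by
  have hfst : Continuous (fun x : Fin (m + 1) → ℝ => firstCoord x) := by
    have : (fun x : Fin (m + 1) → ℝ => firstCoord x) = fun x => x 0 := by
      funext x; simp [firstCoord]
    rw [this]; fun_prop
  have hmk : Continuous (fun x : Fin (m + 1) → ℝ => minkGamma x) := by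
    unfold minkGamma; fun_prop
  have hre : 0 < ((α - ((m + 1 : ℕ) : ℂ)) / 2).re := by
    have : ((α - ((m + 1 : ℕ) : ℂ)) / 2) = (((1 / 2 : ℝ)) : ℂ) * (α - (((m + 1 : ℕ) : ℝ) : ℂ)) := by
      push_cast; ring
    rw [this, Complex.re_ofReal_mul, Complex.sub_re, Complex.ofReal_re]
    linarith
  set h : (Fin (m + 1) → ℝ) → ℂ := fun x =>
    rieszCoeff α (m + 1) * (minkGamma x : ℂ) ^ ((α - ((m + 1 : ℕ) : ℂ)) / 2) * f (firstCoord x)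
  have hh : Continuous h :=
    (continuous_const.mul ((Complex.continuous_ofReal_cpow_const hre).comp hmk)).mul (hf.comp hfst)
  set K : Set (Fin (m + 1) → ℝ) := {x | inCausalFuture x ∧ firstCoord x ∈ tsupport f} with hK
  have hKc : IsClosed K := by
    have e : K = ({x | 0 ≤ minkGamma x} ∩ {x | 0 ≤ firstCoord x}) ∩ firstCoord ⁻¹' (tsupport f) := by
      ext x; simp [hK, inCausalFuture]
    rw [e]
    exact ((isClosed_le continuous_const hmk).inter (isClosed_le continuous_const hfst)).inter
      ((isClosed_tsupport f).preimage hfst)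
  obtain ⟨T, hT⟩ := hfc.isCompact.isBounded.subset_closedBall 0
  have hKcomp : IsCompact K := by
    refine (isCompact_univ_pi (fun _ : Fin (m + 1) => isCompact_Icc (a := -T) (b := T))).of_isClosed_subset
      hKc ?_
    rintro x ⟨⟨hx1, hx2⟩, hx3⟩ i -
    have h3 := hT hx3
    rw [Metric.mem_closedBall, dist_zero_right, Real.norm_eq_abs, abs_of_nonneg hx2] at h3
    have hs : x i ^ 2 ≤ firstCoord x ^ 2 := by
      have e0 : firstCoord x = x 0 := by simp [firstCoord]
      unfold minkGamma at hx1
      by_cases hi : i = 0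
      · rw [hi, e0]
      · have : x 0 ^ 2 + x i ^ 2 ≤ ∑ j, x j ^ 2 := by
          rw [← Finset.sum_pair (f := fun j => x j ^ 2) (Ne.symm hi)]
          exact Finset.sum_le_sum_of_subset_of_nonneg (Finset.subset_univ _)
            (fun _ _ _ => sq_nonneg _)
        rw [e0] at hx1 ⊢
        linarith
    have := abs_le_of_sq_le_sq' hs hx2
    exact ⟨by linarith [this.1], by linarith [this.2]⟩
  have : (fun x : Fin (m + 1) → ℝ => rieszPlus (m + 1) α x * f (firstCoord x)) = K.indicator h := by
    funext x
    by_cases h1 : inCausalFuture x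
    · by_cases h2 : firstCoord x ∈ tsupport f
      · rw [Set.indicator_of_mem (show x ∈ K from ⟨h1, h2⟩)]
        simp [rieszPlus, h1, h]
      · rw [Set.indicator_of_notMem (fun hx : x ∈ K => h2 hx.2), image_eq_zero_of_notMem_tsupport h2,
          mul_zero]
    · rw [Set.indicator_of_notMem (fun hx : x ∈ K => h1 hx.1)]
      simp [rieszPlus, h1]
  rw [this, integrable_indicator_iff hKc.measurableSet]
  exact hh.continuousOn.integrableOn_compact hKcomp

/-- Let `n ≥ 2` and `α ∈ ℂ` with `Re α > n`.  Then for every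
continuous compactly supported `f : ℝ → ℂ` one has
`∫_{ℝⁿ} R₊(α)(x) f(x₁) dx = (1/Γ(α)) ∫₀^∞ r^{α−1} f(r) dr`. -/
theorem riesz_plus_integral_against_first_coordinate
    (n : ℕ) (hn : 2 ≤ n) (α : ℂ) (hα : (n : ℝ) < α.re)
    (f : ℝ → ℂ) (hf : Continuous f) (hfc : HasCompactSupport f) :
    ∫ x : Fin n → ℝ, rieszPlus n α x * f (firstCoord x) =
      (1 / Complex.Gamma α) * ∫ r in Set.Ioi (0 : ℝ), (r : ℂ) ^ (α - 1) * f r := by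
  obtain ⟨m, rfl⟩ : ∃ m, n = m + 1 := ⟨n - 1, by omega⟩
  have hm : 1 ≤ m := by omega
  have hre : 0 < ((α - ((m + 1 : ℕ) : ℂ)) / 2).re := by
    have : ((α - ((m + 1 : ℕ) : ℂ)) / 2) = (((1 / 2 : ℝ)) : ℂ) * (α - (((m + 1 : ℕ) : ℝ) : ℂ)) := by
      push_cast; ring
    rw [this, Complex.re_ofReal_mul, Complex.sub_re, Complex.ofReal_re]
    linarith
  have hmp := (volume_preserving_piFinSuccAbove (fun _ : Fin (m + 1) => ℝ) 0).symm
  have hInteg := (hmp.integrable_comp_emb (MeasurableEquiv.measurableEmbedding _)).mpr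
    (riesz_integrable m α hα f hf hfc)
  rw [← hmp.integral_comp' (fun x : Fin (m + 1) → ℝ => rieszPlus (m + 1) α x * f (firstCoord x))]
  rw [Measure.volume_eq_prod] at hInteg ⊢
  simp only [Function.comp_def] at hInteg
  rw [integral_prod _ hInteg]
  have e0 : ∀ (t : ℝ) (y : Fin m → ℝ),
      firstCoord ((MeasurableEquiv.piFinSuccAbove (fun _ : Fin (m + 1) => ℝ) 0).symm (t, y)) = t := by
    intro t y
    simp [firstCoord, MeasurableEquiv.piFinSuccAbove_symm_apply, Fin.insertNthEquiv]
  have e1 : ∀ (t : ℝ) (y : Fin m → ℝ),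
      minkGamma ((MeasurableEquiv.piFinSuccAbove (fun _ : Fin (m + 1) => ℝ) 0).symm (t, y)) =
        t ^ 2 - ∑ i, y i ^ 2 := by
    intro t y
    unfold minkGamma
    rw [e0, Fin.sum_univ_succ]
    simp [MeasurableEquiv.piFinSuccAbove_symm_apply, Fin.insertNthEquiv]
    ring
  simp only [rieszPlus, inCausalFuture, e0, e1]
  rw [← setIntegral_eq_integral_of_forall_compl_eq_zero (s := Set.Ici (0 : ℝ)) (by
    intro t ht
    have ht : ¬ (0 ≤ t) := ht
    simp [ht]), integral_Ici_eq_integral_Ioi, ← integral_const_mul]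
  refine setIntegral_congr_fun measurableSet_Ioi fun t ht => ?_
  have ht : 0 < t := ht
  have htc : (t : ℂ) ≠ 0 := by exact_mod_cast ht.ne'
  have hi := riesz_inner m hm _ hre t ht
  have hpow : ((t ^ 2 : ℝ) : ℂ) ^ ((m : ℂ) / 2 + (α - ((m + 1 : ℕ) : ℂ)) / 2) =
      (t : ℂ) ^ (α - 1) := by
    rw [show t ^ 2 = t * t by ring, Complex.ofReal_mul,
      Complex.mul_cpow_ofReal_nonneg ht.le ht.le, ← Complex.cpow_add _ _ htc]
    congr 1; push_cast; ring
  rw [hpow] at hi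
  have hc := riesz_const m α hα
  calc _ = ∫ y : Fin m → ℝ, (rieszCoeff α (m + 1) * f t) * (if ∑ i, y i ^ 2 ≤ t ^ 2 then
      (((t ^ 2 - ∑ i, y i ^ 2 : ℝ) : ℂ)) ^ ((α - ((m + 1 : ℕ) : ℂ)) / 2) else 0) := by
        congr 1
        funext y
        by_cases h : ∑ i, y i ^ 2 ≤ t ^ 2
        · rw [if_pos h, if_pos ⟨by linarith, ht.le⟩]; ring
        · rw [if_neg h, if_neg (fun h' => h (by linarith [h'.1]))]; ring
    _ = _ := by
        rw [integral_const_mul, hi, ← hc]; ring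
end

section
/- Let n ≥ 2 and let α ∈ ℂ with Re(α) > n + 2. Then the function R₊(α+2) : ℝⁿ → ℂ is twice continuously differentiable, and for every x ∈ ℝⁿ it satisfies □R₊(α+2)(x) = R₊(α)(x), where □ = ∂²/∂x₁² − ∂²/∂x₂² − ⋯ − ∂²/∂xₙ² is the d'Alembert operator of Minkowski space. -/
open MeasureTheory

/-- The second derivative of `u : ℝⁿ → ℂ` in the `i`-th coordinate direction. -/
noncomputable def coordSecondDeriv {n : ℕ} (u : (Fin n → ℝ) → ℂ) (i : Fin n)
    (x : Fin n → ℝ) : ℂ :=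
  fderiv ℝ (fun y => fderiv ℝ u y (Pi.single i 1)) x (Pi.single i 1)

/-- The d'Alembert operator of Minkowski space,
`□u = ∂²u/∂x₁² − ∂²u/∂x₂² − ⋯ − ∂²u/∂xₙ²`. -/
noncomputable def dAlembert (n : ℕ) (u : (Fin n → ℝ) → ℂ) (x : Fin n → ℝ) : ℂ :=
  if h : 0 < n then
    2 * coordSecondDeriv u ⟨0, h⟩ x - ∑ i, coordSecondDeriv u i x
  else 0

/-- signature -/
noncomputable def mEps {n : ℕ} (i : Fin n) : ℝ := if i.val = 0 then 1 else -1

lemma mEps_sq {n : ℕ} (i : Fin n) : mEps i * mEps i = 1 := by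
  unfold mEps; split_ifs <;> norm_num

lemma two_sub_sum {n : ℕ} (h : 0 < n) {R : Type*} [CommRing R] [Algebra ℝ R] (f : Fin n → R) :
    2 * f ⟨0, h⟩ - ∑ i, f i = ∑ i, algebraMap ℝ R (mEps i) * f i := by
  obtain ⟨m, rfl⟩ : ∃ m, n = m + 1 := ⟨n - 1, by omega⟩
  rw [Fin.sum_univ_succ, Fin.sum_univ_succ]
  simp [mEps]
  ring

lemma minkGamma_eq {n : ℕ} (h : 0 < n) (x : Fin n → ℝ) :
    minkGamma x = ∑ i, mEps i * x i ^ 2 := by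
  have := two_sub_sum h (R := ℝ) (fun i => x i ^ 2)
  simpa [minkGamma, firstCoord, h] using this

lemma minkGamma_le {n : ℕ} (h : 0 < n) (x : Fin n → ℝ) : minkGamma x ≤ firstCoord x ^ 2 := by
  have : x ⟨0, h⟩ ^ 2 ≤ ∑ i, x i ^ 2 :=
    Finset.single_le_sum (f := fun i => x i ^ 2) (fun i _ => sq_nonneg _) (Finset.mem_univ _)
  simp only [minkGamma, firstCoord, h, dif_pos]
  linarith

lemma continuous_firstCoord {n : ℕ} (h : 0 < n) :
    Continuous (firstCoord : (Fin n → ℝ) → ℝ) := by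
  have : (firstCoord : (Fin n → ℝ) → ℝ) = fun x => x ⟨0, h⟩ := by
    funext x; simp [firstCoord, h]
  rw [this]; fun_prop

/-- derivative of the quadratic form -/
noncomputable def dGam {n : ℕ} (x : Fin n → ℝ) : (Fin n → ℝ) →L[ℝ] ℝ :=
  ∑ i, (2 * mEps i * x i) • ContinuousLinearMap.proj (R := ℝ) (φ := fun _ : Fin n => ℝ) i

lemma dGam_single {n : ℕ} (x : Fin n → ℝ) (i : Fin n) :
    dGam x (Pi.single i 1) = 2 * mEps i * x i := by
  simp [dGam, Pi.single_apply]

lemma hasFDerivAt_minkGamma {n : ℕ} (h : 0 < n) (x : Fin n → ℝ) :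
    HasFDerivAt (minkGamma : (Fin n → ℝ) → ℝ) (dGam x) x := by
  have e : (minkGamma : (Fin n → ℝ) → ℝ) = fun x => ∑ i, mEps i * x i ^ 2 := by
    funext x; exact minkGamma_eq h x
  rw [e]
  refine HasFDerivAt.fun_sum (fun i _ => ?_)
  have := ((hasFDerivAt_apply (𝕜 := ℝ) (F' := fun _ : Fin n => ℝ) i x).pow 2).const_mul (mEps i)
  refine this.congr_fderiv ?_
  ext v
  simp
  ring

lemma contDiff_dGam {n : ℕ} : ContDiff ℝ 1 (dGam : (Fin n → ℝ) → _) := by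
  unfold dGam
  fun_prop

/-- unnormalised Riesz function -/
noncomputable def rF {n : ℕ} (s : ℂ) (x : Fin n → ℝ) : ℂ :=
  if inCausalFuture x then (minkGamma x : ℂ) ^ s else 0

lemma norm_rF_le {n : ℕ} {s : ℂ} (hs : 0 < s.re) (x : Fin n → ℝ) :
    ‖rF s x‖ ≤ |minkGamma x| ^ s.re := by
  unfold rF
  split_ifs with hx
  · rw [Complex.norm_cpow_eq_rpow_re_of_nonneg hx.1 hs.ne', abs_of_nonneg hx.1]
  · simpa using Real.rpow_nonneg (abs_nonneg _) _

lemma rF_zero {n : ℕ} {s : ℂ} (hs : 0 < s.re) {x : Fin n → ℝ} (hx : minkGamma x = 0) :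
    rF s x = 0 := by
  have := norm_rF_le hs x
  rw [hx, abs_zero, Real.zero_rpow hs.ne'] at this
  simpa using this

/-- case split -/
lemma cases_pt {n : ℕ} (h : 0 < n) (x : Fin n → ℝ) :
    (minkGamma x ≠ 0 ∧ ∀ᶠ y in nhds x, inCausalFuture y) ∨
    (∀ᶠ y in nhds x, ¬ inCausalFuture y) ∨ minkGamma x = 0 := by
  have cg : ContinuousAt (minkGamma : (Fin n → ℝ) → ℝ) x :=
    (hasFDerivAt_minkGamma h x).continuousAt
  have cf := (continuous_firstCoord h).continuousAt (x := x)
  have hle := minkGamma_le h x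
  rcases lt_trichotomy (minkGamma x) 0 with hg | hg | hg
  · right; left
    filter_upwards [cg.eventually_lt_const hg] with y hy hc
    exact absurd hc.1 (not_le.2 hy)
  · exact Or.inr (Or.inr hg)
  · rcases lt_trichotomy (firstCoord x) 0 with hf | hf | hf
    · right; left
      filter_upwards [cf.eventually_lt_const hf] with y hy hc
      exact absurd hc.2 (not_le.2 hy)
    · rw [hf] at hle; norm_num at hle; linarith
    · left
      refine ⟨hg.ne', ?_⟩
      filter_upwards [cg.eventually_const_lt hg, cf.eventually_const_lt hf] with y h1 h2
      exact ⟨h1.le, h2.le⟩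

lemma continuous_minkGamma {n : ℕ} (h : 0 < n) : Continuous (minkGamma : (Fin n → ℝ) → ℝ) :=
  continuous_iff_continuousAt.2 fun x => (hasFDerivAt_minkGamma h x).continuousAt

lemma continuous_rF {n : ℕ} (h : 0 < n) {s : ℂ} (hs : 0 < s.re) :
    Continuous (rF s : (Fin n → ℝ) → ℂ) := by
  rw [continuous_iff_continuousAt]
  intro x
  rcases cases_pt h x with ⟨_, hx⟩ | hx | hx
  · have e : (rF s : (Fin n → ℝ) → ℂ) =ᶠ[nhds x] fun y => (minkGamma y : ℂ) ^ s := by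
      filter_upwards [hx] with y hy
      simp [rF, hy]
    refine ContinuousAt.congr ?_ e.symm
    have := (Complex.continuousAt_ofReal_cpow_const (minkGamma x) s (Or.inl hs))
    exact ContinuousAt.comp (g := fun t : ℝ => (t : ℂ) ^ s) this
      (continuous_minkGamma h).continuousAt
  · have e : (rF s : (Fin n → ℝ) → ℂ) =ᶠ[nhds x] fun y => 0 := by
      filter_upwards [hx] with y hy
      simp [rF, hy]
    exact ContinuousAt.congr continuousAt_const e.symm
  · rw [ContinuousAt, rF_zero hs hx]
    refine squeeze_zero_norm (norm_rF_le hs) ?_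
    have : Continuous fun y : Fin n → ℝ => |minkGamma y| ^ s.re :=
      (continuous_minkGamma h).abs.rpow_const (fun _ => Or.inr hs.le)
    have := this.tendsto x
    simpa [hx, Real.zero_rpow hs.ne'] using this

lemma hasFDerivAt_rF {n : ℕ} (h : 0 < n) {s : ℂ} (hs : 1 < s.re) (x : Fin n → ℝ) :
    HasFDerivAt (rF s : (Fin n → ℝ) → ℂ)
      ((s * rF (s - 1) x) • (Complex.ofRealCLM ∘L dGam x)) x := by
  have hs1 : 0 < (s - 1).re := by simpa using hs
  rcases cases_pt h x with ⟨h0, hx⟩ | hx | hx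
  · have e : (rF s : (Fin n → ℝ) → ℂ) =ᶠ[nhds x] fun y => (minkGamma y : ℂ) ^ s := by
      filter_upwards [hx] with y hy
      simp [rF, hy]
    refine HasFDerivAt.congr_of_eventuallyEq ?_ e
    have hs0 : s ≠ 0 := by
      rintro rfl; norm_num at hs
    have hd := hasDerivAt_ofReal_cpow_const (x := minkGamma x) h0 hs0
    have := hd.hasFDerivAt.comp x (hasFDerivAt_minkGamma h x)
    refine this.congr_fderiv ?_
    ext v
    have hx' := hx.self_of_nhds
    simp [rF, hx']
    ring
  · have e : (rF s : (Fin n → ℝ) → ℂ) =ᶠ[nhds x] fun y => 0 := by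
      filter_upwards [hx] with y hy
      simp [rF, hy]
    refine HasFDerivAt.congr_of_eventuallyEq ?_ e
    have hx' := hx.self_of_nhds
    refine (hasFDerivAt_const (0 : ℂ) x).congr_fderiv ?_
    ext v
    simp [rF, hx']
  · rw [rF_zero hs1 hx]
    have hz : (s * 0) • (Complex.ofRealCLM ∘L dGam x) = 0 := by
      ext v
      simp
    rw [hz]
    rw [hasFDerivAt_iff_isLittleO]
    simp only [rF_zero (by linarith : 0 < s.re) hx, zero_apply, sub_zero]
    have hO : (fun y : Fin n → ℝ => minkGamma y) =O[nhds x] fun y => y - x := by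
      have := (hasFDerivAt_minkGamma h x).isBigO_sub
      simpa [hx] using this
    refine Asymptotics.IsLittleO.trans_isBigO ?_ hO
    have h1 : (rF s : (Fin n → ℝ) → ℂ) =O[nhds x]
        fun y => |minkGamma y| ^ (s.re - 1) * minkGamma y := by
      refine Asymptotics.IsBigO.of_bound 1 (Filter.Eventually.of_forall fun y => ?_)
      refine (norm_rF_le (by linarith) y).trans ?_
      rw [one_mul, norm_mul, Real.norm_eq_abs, Real.norm_eq_abs,
        abs_of_nonneg (Real.rpow_nonneg (abs_nonneg _) _)]
      rcases eq_or_ne (minkGamma y) 0 with h0 | h0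
      · simp [h0, Real.zero_rpow (by linarith : s.re ≠ 0)]
      · rw [Real.rpow_sub_one (abs_ne_zero.2 h0), div_mul_cancel₀ _ (abs_ne_zero.2 h0)]
    refine h1.trans_isLittleO ?_
    have h2 : (fun y : Fin n → ℝ => |minkGamma y| ^ (s.re - 1)) =o[nhds x] fun _ => (1 : ℝ) := by
      rw [Asymptotics.isLittleO_one_iff]
      have : Continuous fun y : Fin n → ℝ => |minkGamma y| ^ (s.re - 1) :=
        (continuous_minkGamma h).abs.rpow_const (fun _ => Or.inr (by linarith))
      have := this.tendsto x
      simpa [hx, Real.zero_rpow (by linarith : s.re - 1 ≠ 0)] using this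
    simpa using h2.mul_isBigO (Asymptotics.isBigO_refl (fun y : Fin n → ℝ => minkGamma y) (nhds x))

lemma contDiff_ofReal_dGam {n : ℕ} :
    ContDiff ℝ 1 (fun x : Fin n → ℝ => Complex.ofRealCLM ∘L dGam x) :=
  contDiff_const.clm_comp contDiff_dGam

lemma contDiff_one_rF {n : ℕ} (h : 0 < n) {s : ℂ} (hs : 1 < s.re) :
    ContDiff ℝ 1 (rF s : (Fin n → ℝ) → ℂ) := by
  have hs1 : 0 < (s - 1).re := by simpa using hs
  rw [contDiff_one_iff_fderiv]
  refine ⟨fun x => (hasFDerivAt_rF h hs x).differentiableAt, ?_⟩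
  rw [show fderiv ℝ (rF s : (Fin n → ℝ) → ℂ) = _ from
    funext fun x => (hasFDerivAt_rF h hs x).fderiv]
  exact (continuous_const.mul (continuous_rF h hs1)).smul contDiff_ofReal_dGam.continuous

lemma contDiff_two_rF {n : ℕ} (h : 0 < n) {s : ℂ} (hs : 2 < s.re) :
    ContDiff ℝ 2 (rF s : (Fin n → ℝ) → ℂ) := by
  have hs1 : 1 < (s - 1).re := by simp; linarith
  have hs' : 1 < s.re := by linarith
  rw [show (2 : WithTop ℕ∞) = 1 + 1 by norm_num, contDiff_succ_iff_fderiv]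
  refine ⟨fun x => (hasFDerivAt_rF h hs' x).differentiableAt, by simp, ?_⟩
  rw [show fderiv ℝ (rF s : (Fin n → ℝ) → ℂ) = _ from
    funext fun x => (hasFDerivAt_rF h hs' x).fderiv]
  exact (contDiff_const.mul (contDiff_one_rF h hs1)).smul contDiff_ofReal_dGam

lemma rF_mul {n : ℕ} {s : ℂ} (hs : 1 < s.re) (x : Fin n → ℝ) :
    rF (s - 1) x * minkGamma x = rF s x := by
  rcases eq_or_ne (minkGamma x) 0 with h0 | h0
  · rw [rF_zero (s := s) (by linarith) h0, h0]; simp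
  · unfold rF
    split_ifs
    · rw [Complex.cpow_sub _ _ (by exact_mod_cast h0), Complex.cpow_one, div_mul_cancel₀ _ (by exact_mod_cast h0)]
    · simp

lemma rieszPlus_eq {n : ℕ} (α : ℂ) :
    rieszPlus n α = fun x => rieszCoeff α n * rF ((α - n) / 2) x := by
  funext x
  simp [rieszPlus, rF]

lemma coordSecondDeriv_rF {n : ℕ} (h : 0 < n) {s : ℂ} (hs : 1 < s.re) (c : ℂ) (i : Fin n)
    (x : Fin n → ℝ) :
    coordSecondDeriv (fun x => c * rF (s + 1) x) i x =
      c * (s + 1) * (4 * s * rF (s - 1) x * (x i : ℂ) ^ 2 + 2 * (mEps i : ℂ) * rF s x) := by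
  have hs1 : 1 < (s + 1).re := by simp; linarith
  have e : (fun y => fderiv ℝ (fun x => c * rF (s + 1) x) y (Pi.single i 1)) =
      fun y : Fin n → ℝ => (c * (s + 1)) * (rF s y * ((2 * mEps i * y i : ℝ) : ℂ)) := by
    funext y
    rw [((hasFDerivAt_rF h hs1 y).const_mul c).fderiv]
    simp [dGam_single]
    ring
  unfold coordSecondDeriv
  rw [e]
  have hp : HasFDerivAt (fun y : Fin n → ℝ => 2 * mEps i * y i)
      ((2 * mEps i) • ContinuousLinearMap.proj (R := ℝ) (φ := fun _ : Fin n => ℝ) i) x :=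
    (hasFDerivAt_apply (𝕜 := ℝ) (F' := fun _ : Fin n => ℝ) i x).const_mul (2 * mEps i)
  have hp' := Complex.ofRealCLM.hasFDerivAt.comp x hp
  have := ((hasFDerivAt_rF h hs x).mul hp').const_mul (c * (s + 1))
  have h3 := this.fderiv
  have h4 : (mEps i : ℂ) * mEps i = 1 := by exact_mod_cast mEps_sq i
  refine (congrArg (fun L => L (Pi.single i 1)) h3).trans ?_
  simp [dGam_single]
  linear_combination (c * (s + 1) * 4 * s * rF (s - 1) x * (x i : ℂ) ^ 2) * h4

lemma rieszCoeff_rec {n : ℕ} {α : ℂ} (h1 : α ≠ 0) (h2 : α - n + 2 ≠ 0) :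
    rieszCoeff (α + 2) n * ((α - n + 2) * α) = rieszCoeff α n := by
  unfold rieszCoeff
  rw [show (α + 2) / 2 = α / 2 + 1 by ring,
    show (α + 2 - (n : ℂ) + 2) / 2 = (α - n + 2) / 2 + 1 by ring,
    Complex.Gamma_add_one _ (by simpa using h1), Complex.Gamma_add_one _ (by simpa using h2),
    show (1 : ℂ) - (α + 2) = (1 - α) - (2 : ℕ) by push_cast; ring,
    Complex.cpow_sub _ _ two_ne_zero, Complex.cpow_natCast]
  generalize (2 : ℂ) ^ (1 - α) = A
  generalize (Real.pi : ℂ) ^ (((2 : ℂ) - n) / 2) = B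
  generalize Complex.Gamma (α / 2) = C
  generalize Complex.Gamma ((α - n + 2) / 2) = D
  generalize α - n + 2 = E at *
  rcases eq_or_ne C 0 with rfl | hC
  · simp
  rcases eq_or_ne D 0 with rfl | hD
  · simp
  field_simp

theorem dAlembert_riesz_plus
    (n : ℕ) (hn : 2 ≤ n) (α : ℂ) (hα : (n : ℝ) + 2 < α.re) :
    ContDiff ℝ 2 (rieszPlus n (α + 2)) ∧
    ∀ x : Fin n → ℝ, dAlembert n (rieszPlus n (α + 2)) x = rieszPlus n α x := by
  have h : 0 < n := by omega
  have hn0 : (0 : ℝ) ≤ n := Nat.cast_nonneg n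
  set s : ℂ := (α - n) / 2 with hsdef
  have hre : s.re = (α.re - n) / 2 := by simp [hsdef]
  have hs : 1 < s.re := by rw [hre]; linarith
  have e : rieszPlus n (α + 2) = fun x => rieszCoeff (α + 2) n * rF (s + 1) x := by
    rw [rieszPlus_eq, show (α + 2 - (n : ℂ)) / 2 = s + 1 by rw [hsdef]; ring]
  have h1 : α ≠ 0 := by
    rintro rfl; simp at hα; linarith
  have h2 : α - n + 2 ≠ 0 := by
    intro hh
    have := congrArg Complex.re hh
    simp at this; linarith
  constructor
  · rw [e]
    exact contDiff_const.mul (contDiff_two_rF h (by simp; linarith))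
  · intro x
    rw [e, rieszPlus_eq, ← hsdef, dAlembert, dif_pos h,
      two_sub_sum h (fun i => coordSecondDeriv (fun x => rieszCoeff (α + 2) n * rF (s + 1) x) i x)]
    simp only [coordSecondDeriv_rF h hs]
    rw [← rieszCoeff_rec h1 h2]
    have hsum : ∀ i : Fin n, algebraMap ℝ ℂ (mEps i) * (rieszCoeff (α + 2) n * (s + 1) *
        (4 * s * rF (s - 1) x * (x i : ℂ) ^ 2 + 2 * (mEps i : ℂ) * rF s x)) =
        rieszCoeff (α + 2) n * (s + 1) * (4 * s * rF (s - 1) x) * ((mEps i * x i ^ 2 : ℝ) : ℂ) +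
        rieszCoeff (α + 2) n * (s + 1) * 2 * rF s x := by
      intro i
      have h4 : (mEps i : ℂ) * mEps i = 1 := by exact_mod_cast mEps_sq i
      simp only [Complex.coe_algebraMap]
      push_cast
      linear_combination (rieszCoeff (α + 2) n * (s + 1) * 2 * rF s x) * h4
    rw [Finset.sum_congr rfl (fun i _ => hsum i), Finset.sum_add_distrib, ← Finset.mul_sum,
      ← Complex.ofReal_sum, ← minkGamma_eq h]
    simp only [Finset.sum_const, Finset.card_univ, Fintype.card_fin, nsmul_eq_mul]
    have h5 := rF_mul hs x
    have h6 : α = 2 * s + n := by rw [hsdef]; ring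
    generalize rieszCoeff (α + 2) n = K
    rw [h6]
    linear_combination (K * (s + 1) * 4 * s) * h5
end

section
/- Let n ≥ 2 and k ∈ ℕ, and let f : ℝⁿ → ℝ be a function of class C^{3k+1} that vanishes on all spacelike vectors, i.e. f(x) = 0 whenever γ(x) < 0. Then there exists a continuous function h : ℝⁿ → ℝ such that f(x) = h(x)·γ(x)^k for all x ∈ ℝⁿ. -/
lemma fg_gamma_eq {N : ℕ} (x : Fin (N+1) → ℝ) :
    minkGamma x = x 0 ^ 2 - ∑ i : Fin N, x i.succ ^ 2 := by
  have : firstCoord x = x 0 := by simp [firstCoord]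
  rw [minkGamma, this, Fin.sum_univ_succ]; ring

lemma fg_gamma_upd {N : ℕ} (x : Fin (N+1) → ℝ) (s : ℝ) :
    minkGamma (Function.update x 0 s) = s ^ 2 - ∑ i : Fin N, x i.succ ^ 2 := by
  rw [fg_gamma_eq]
  simp

lemma fg_gamma_cont {N : ℕ} : Continuous (fun x : Fin (N+1) → ℝ => minkGamma x) := by
  simp_rw [fg_gamma_eq]
  fun_prop

lemma fg_vanish {N : ℕ} (f : (Fin (N+2) → ℝ) → ℝ) (hf : Continuous f)
    (hv : ∀ x, minkGamma x < 0 → f x = 0) (x : Fin (N+2) → ℝ) (hx : minkGamma x ≤ 0) :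
    f x = 0 := by
  obtain ⟨σ, hσ, hσx⟩ : ∃ σ : ℝ, σ ^ 2 = 1 ∧ 0 ≤ σ * x 1 := by
    rcases le_total 0 (x 1) with h | h
    · exact ⟨1, by norm_num, by linarith⟩
    · exact ⟨-1, by norm_num, by linarith⟩
  let g : ℝ → (Fin (N+2) → ℝ) := fun ε => Function.update x 1 (x 1 + ε * σ)
  have hg : Continuous g := by
    apply Continuous.update continuous_const; fun_prop
  have h0 : g 0 = x := by simp [g]
  have hneg : ∀ ε > 0, f (g ε) = 0 := by
    intro ε hε
    apply hv
    rw [fg_gamma_eq] at hx ⊢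
    rw [Fin.sum_univ_succ] at hx ⊢
    have e1 : g ε 0 = x 0 := by simp [g]
    have e2 : g ε (Fin.succ 0) = x 1 + ε * σ := by simp [g]
    have e3 : ∀ i : Fin N, g ε i.succ.succ = x i.succ.succ := by
      intro i
      apply Function.update_of_ne
      rw [← Fin.succ_zero_eq_one]
      intro h
      exact Fin.succ_ne_zero _ (Fin.succ_injective _ h)
    simp only [e1, e2, e3]
    have : (x (Fin.succ 0)) = x 1 := rfl
    rw [this] at hx
    have h3 : 0 < ε ^ 2 := by positivity
    have h4 : 0 ≤ ε * (σ * x 1) := by positivity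
    have : (x 1 + ε * σ) ^ 2 = x 1 ^ 2 + 2 * (ε * (σ * x 1)) + ε ^ 2 := by
      have : (x 1 + ε * σ) ^ 2 = x 1 ^ 2 + 2 * (ε * (σ * x 1)) + ε ^ 2 * σ ^ 2 := by ring
      rw [this, hσ, mul_one]
    linarith
  have ht : Filter.Tendsto (fun ε => f (g ε)) (nhdsWithin 0 (Set.Ioi 0)) (nhds (f x)) := by
    have := (hf.comp hg).tendsto 0
    simp only [Function.comp_apply, h0] at this
    exact this.mono_left nhdsWithin_le_nhds
  have ht2 : Filter.Tendsto (fun ε => f (g ε)) (nhdsWithin 0 (Set.Ioi 0)) (nhds 0) := by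
    apply tendsto_const_nhds.congr'
    filter_upwards [self_mem_nhdsWithin] with ε hε
    exact (hneg ε hε).symm
  exact tendsto_nhds_unique ht ht2

lemma fg_bound {N : ℕ} (m : ℕ) : ∀ (f : (Fin (N+2) → ℝ) → ℝ) (_ : ContDiff ℝ m f)
    (_ : ∀ x, minkGamma x < 0 → f x = 0) (R : ℝ), ∃ C : ℝ, 0 ≤ C ∧ ∀ x, ‖x‖ ≤ R →
      0 ≤ minkGamma x → |f x| ≤ C * Real.sqrt (minkGamma x) ^ m := by
  induction m with
  | zero =>
    intro f hf hv R
    obtain ⟨C, hC⟩ := (isCompact_closedBall (0 : Fin (N+2) → ℝ) R).exists_bound_of_continuousOn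
      hf.continuous.continuousOn
    refine ⟨max C 0, le_max_right _ _, fun x hx _ => ?_⟩
    simpa using Or.inl (hC x (by simpa using hx))
  | succ m ih =>
    intro f hf hv R
    have hfd : Differentiable ℝ f := hf.differentiable (by simp)
    let e : Fin (N+2) → ℝ := Pi.single 0 1
    obtain ⟨C, hC0, hC⟩ := ih (fun x => fderiv ℝ f x e)
      ((hf.fderiv_right (m := m) (by norm_cast)).clm_apply contDiff_const)
      (by
        intro x hx
        have : f =ᶠ[nhds x] fun _ => 0 := by
          filter_upwards [(isOpen_Iio.preimage (fg_gamma_cont (N := N+1))).mem_nhds hx] with y hy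
          exact hv y hy
        rw [this.fderiv_eq]; simp) R
    refine ⟨C, hC0, fun x hx hg => ?_⟩
    set S := ∑ i : Fin (N+1), x i.succ ^ 2 with hS
    have hS0 : 0 ≤ S := Finset.sum_nonneg fun i _ => sq_nonneg _
    have hgx : minkGamma x = x 0 ^ 2 - S := fg_gamma_eq x
    set r := Real.sqrt S with hr
    have hr0 : 0 ≤ r := Real.sqrt_nonneg _
    have hr2 : r ^ 2 = S := Real.sq_sqrt hS0
    obtain ⟨c, hc2, hcs, hcd⟩ : ∃ c : ℝ, c ^ 2 = S ∧
        (∀ s ∈ Set.uIcc c (x 0), c ^ 2 ≤ s ^ 2 ∧ s ^ 2 ≤ x 0 ^ 2) ∧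
        (x 0 - c) ^ 2 ≤ x 0 ^ 2 - c ^ 2 := by
      rcases le_total 0 (x 0) with h | h
      · have : r ≤ x 0 := by apply le_of_sq_le_sq _ h; linarith
        refine ⟨r, hr2, ?_, by nlinarith⟩
        intro s hs
        rw [Set.uIcc_of_le this] at hs
        obtain ⟨h1, h2⟩ := hs
        constructor <;> nlinarith
      · have : r ≤ - x 0 := by apply le_of_sq_le_sq _ (by linarith); nlinarith
        refine ⟨-r, by linarith [neg_sq r], ?_, by nlinarith⟩
        intro s hs
        rw [Set.uIcc_of_ge (by linarith)] at hs
        obtain ⟨h1, h2⟩ := hs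
        constructor <;> nlinarith
    have hderiv : ∀ s : ℝ, HasDerivAt (fun s => f (Function.update x 0 s))
        (fderiv ℝ f (Function.update x 0 s) e) s := fun s =>
      (hfd _).hasFDerivAt.comp_hasDerivAt s (hasDerivAt_update x 0 s)
    have hb : ∀ s ∈ Set.uIcc c (x 0), ‖fderiv ℝ f (Function.update x 0 s) e‖ ≤
        C * Real.sqrt (minkGamma x) ^ m := by
      intro s hs
      obtain ⟨h1, h2⟩ := hcs s hs
      have hgs := fg_gamma_upd x s
      rw [← hS] at hgs
      refine (hC _ ?_ (by rw [hgs]; linarith)).trans ?_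
      · refine le_trans ?_ hx
        rw [pi_norm_le_iff_of_nonneg (norm_nonneg _)]
        intro i
        by_cases hi : i = 0
        · subst hi
          simp only [Function.update_self]
          refine le_trans ?_ (norm_le_pi_norm x 0)
          exact sq_le_sq.mp h2
        · rw [Function.update_of_ne hi]
          exact norm_le_pi_norm x i
      · gcongr
        rw [hgs, hgx]; linarith
    have key := (convex_uIcc c (x 0)).norm_image_sub_le_of_norm_hasDerivWithin_le
      (fun s _ => (hderiv s).hasDerivWithinAt) hb Set.left_mem_uIcc Set.right_mem_uIcc
    have hz : f (Function.update x 0 c) = 0 := by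
      apply fg_vanish f hf.continuous hv
      rw [fg_gamma_upd, ← hS, hc2, sub_self]
    simp only [Function.update_eq_self, hz, sub_zero, Real.norm_eq_abs] at key
    refine key.trans ?_
    rw [pow_succ, ← mul_assoc]
    gcongr
    apply Real.abs_le_sqrt
    rw [hgx, ← hc2]; exact hcd

theorem factor_gamma_power
    (n : ℕ) (hn : 2 ≤ n) (k : ℕ) (f : (Fin n → ℝ) → ℝ)
    (hf : ContDiff ℝ ((3 * k + 1 : ℕ) : ℕ∞) f)
    (hvanish : ∀ x : Fin n → ℝ, minkGamma x < 0 → f x = 0) :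
    ∃ h : (Fin n → ℝ) → ℝ, Continuous h ∧
      ∀ x : Fin n → ℝ, f x = h x * minkGamma x ^ k := by
  obtain ⟨N, rfl⟩ : ∃ N, n = N + 2 := ⟨n - 2, by omega⟩
  have hgc := fg_gamma_cont (N := N+1)
  have hf' : ContDiff ℝ ((2 * k + 1 : ℕ)) f := 
    hf.of_le (by
      have h : 2 * k + 1 ≤ 3 * k + 1 := by omega
      exact WithTop.coe_le_coe.mpr (Nat.cast_le (α := ℕ∞).mpr h))
  refine ⟨fun x => if 0 < minkGamma x then f x / minkGamma x ^ k else 0, ?_, ?_⟩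
  · rw [continuous_iff_continuousAt]
    intro p
    by_cases hp : 0 < minkGamma p
    · have h1 : ContinuousAt (fun x => f x / minkGamma x ^ k) p :=
        hf.continuous.continuousAt.div (hgc.pow k).continuousAt (by positivity)
      apply h1.congr
      filter_upwards [(isOpen_Ioi.preimage hgc).mem_nhds hp] with y hy
      have hy' : 0 < minkGamma y := hy
      simp [hy']
    · obtain ⟨C, hC0, hC⟩ := fg_bound (2 * k + 1) f hf' hvanish (‖p‖ + 1)
      rw [ContinuousAt, if_neg hp]
      have ht : Filter.Tendsto (fun x => C * Real.sqrt (minkGamma x)) (nhds p) (nhds 0) := by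
        have : Continuous (fun x : Fin (N+2) → ℝ => C * Real.sqrt (minkGamma x)) := by fun_prop
        have h2 := this.tendsto p
        rwa [Real.sqrt_eq_zero_of_nonpos (not_lt.mp hp), mul_zero] at h2
      refine squeeze_zero_norm' ?_ ht
      filter_upwards [(isOpen_Iio.preimage continuous_norm).mem_nhds
        (show ‖p‖ < ‖p‖ + 1 by linarith)] with x hx
      have hx' : ‖x‖ < ‖p‖ + 1 := hx
      split_ifs with h
      · rw [norm_div, Real.norm_eq_abs, Real.norm_of_nonneg (by positivity),
          div_le_iff₀ (by positivity)]
        refine (hC x hx'.le h.le).trans (le_of_eq ?_)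
        rw [pow_succ, pow_mul, Real.sq_sqrt h.le]; ring
      · rw [norm_zero]; positivity
  · intro x
    dsimp only
    split_ifs with h
    · field_simp
    · rw [fg_vanish f hf.continuous hvanish x (not_lt.mp h), zero_mul]
end

section
/- Let m ≥ 1 and let k, k₁, k₂ ∈ ℕ with k₁ + k₂ ≤ k. Let φ₁, φ₂ : ℝᵐ → ℝ be smooth functions, put H₁ = φ₁⁻¹({0}) and H₂ = φ₂⁻¹({0}), and assume that the differential dφᵢ(x) is nonzero for every x ∈ Hᵢ (i = 1, 2) and that H₁ and H₂ intersect transversally, i.e. for every x ∈ H₁ ∩ H₂ the differentials dφ₁(x) and dφ₂(x) are linearly independent. Let f : ℝᵐ → ℝ be a C^k-function that vanishes to order k₁ along H₁ and to order k₂ along H₂. Then there exists a continuous function F : ℝᵐ → ℝ such that f(x) = φ₁(x)^{k₁}·φ₂(x)^{k₂}·F(x) for all x ∈ ℝᵐ. -/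
open Topology Set Filter

section Model

variable {E : Type*} [NormedAddCommGroup E] [NormedSpace ℝ E]

/-- Directional derivative. -/
noncomputable def dirD (v : E) (g : E → ℝ) : E → ℝ := fun y => fderiv ℝ g y v

/-- Directional vanishing condition along the kernel of `L`. -/
def VanDir (v : E) (L : E →L[ℝ] ℝ) (l : ℕ) (g : E → ℝ) : Prop :=
  ∀ y, L y = 0 → ∀ j < l, ((dirD v)^[j] g) y = 0

lemma dirD_contDiff (v : E) (g : E → ℝ) (n : ℕ) (hg : ContDiff ℝ ((n + 1 : ℕ) : ℕ∞) g) :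
    ContDiff ℝ (n : ℕ∞) (dirD v g) := by
  have h : ContDiff ℝ (n : ℕ∞) (fderiv ℝ g) := hg.fderiv_right (by norm_cast)
  exact h.clm_apply contDiff_const

lemma dirD_iter_contDiff (v : E) (n j : ℕ) : ∀ (g : E → ℝ),
    ContDiff ℝ ((n + j : ℕ) : ℕ∞) g → ContDiff ℝ (n : ℕ∞) ((dirD v)^[j] g) := by
  induction j with
  | zero => intro g hg; simpa using hg
  | succ j ih =>
    intro g hg
    rw [Function.iterate_succ_apply]
    exact ih _ (dirD_contDiff v g (n + j) hg)

lemma dirD_comm (v w : E) (g : E → ℝ) (hg : ContDiff ℝ ((2 : ℕ) : ℕ∞) g) :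
    dirD v (dirD w g) = dirD w (dirD v g) := by
  have hd : Differentiable ℝ (fderiv ℝ g) := by
    have : ContDiff ℝ ((1 : ℕ) : ℕ∞) (fderiv ℝ g) := hg.fderiv_right (by norm_cast)
    exact this.differentiable (by norm_num)
  funext y
  have key : ∀ a : E, fderiv ℝ (fun z => fderiv ℝ g z a) y =
      (fderiv ℝ (fderiv ℝ g) y).flip a := by
    intro a
    have := ((hd y).hasFDerivAt.clm_apply (hasFDerivAt_const a y)).fderiv
    rw [this]; ext; simp
  have hs : IsSymmSndFDerivAt ℝ g y :=
    (hg.contDiffAt).isSymmSndFDerivAt (by simp)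
  change fderiv ℝ (fun z => fderiv ℝ g z w) y v = fderiv ℝ (fun z => fderiv ℝ g z v) y w
  rw [key, key]
  exact hs v w

lemma dirD_iter_comm (v w : E) (j : ℕ) : ∀ (g : E → ℝ),
    ContDiff ℝ ((j + 1 : ℕ) : ℕ∞) g → (dirD v)^[j] (dirD w g) = dirD w ((dirD v)^[j] g) := by
  induction j with
  | zero => intro g _; rfl
  | succ j ih =>
    intro g hg
    rw [Function.iterate_succ_apply, Function.iterate_succ_apply, dirD_comm v w g, ih]
    · exact dirD_contDiff v g (j + 1) hg
    · exact hg.of_le (by norm_cast; omega)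

lemma VanDir.tangent {v w : E} {L : E →L[ℝ] ℝ} {l n : ℕ} {g : E → ℝ}
    (h : VanDir v L l g) (hg : ContDiff ℝ (n : ℕ∞) g) (hl : l ≤ n) (hw : L w = 0) :
    VanDir v L l (dirD w g) := by
  intro y hy j hj
  have hc : ContDiff ℝ ((j + 1 : ℕ) : ℕ∞) g := hg.of_le (by norm_cast; omega)
  rw [dirD_iter_comm v w j g hc]
  have hd : ContDiff ℝ ((1 : ℕ) : ℕ∞) ((dirD v)^[j] g) :=
    dirD_iter_contDiff v 1 j g (by rwa [add_comm])
  have hdiff := (hd.differentiable (by norm_num) y).hasFDerivAt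
  have hline := hdiff.hasLineDerivAt w
  have h0 : (fun t : ℝ => ((dirD v)^[j] g) (y + t • w)) = fun _ => 0 := by
    funext t
    exact h _ (by simp [hy, hw]) j hj
  unfold HasLineDerivAt at hline
  rw [h0] at hline
  exact hline.unique (hasDerivAt_const 0 0)

lemma VanDir.dir {v : E} {L : E →L[ℝ] ℝ} {l : ℕ} {g : E → ℝ}
    (h : VanDir v L (l + 1) g) : VanDir v L l (dirD v g) := by
  intro y hy j hj
  have := h y hy (j + 1) (by omega)
  rwa [Function.iterate_succ_apply] at this

lemma model_step (L L' : E →L[ℝ] ℝ) (v : E) (hv : L v = 1) (hv' : L' v = 0) (a b : ℕ)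
    (g H : E → ℝ) (hg : ContDiff ℝ ((1 : ℕ) : ℕ∞) g) (h0 : ∀ y, L y = 0 → g y = 0)
    (hH : Continuous H) (hgH : ∀ y, dirD v g y = L y ^ a * L' y ^ b * H y) :
    ∃ G : E → ℝ, Continuous G ∧ ∀ y, g y = L y ^ (a + 1) * L' y ^ b * G y := by
  refine ⟨fun y => ∫ u in (0 : ℝ)..1, u ^ a * H (y - ((1 - u) * L y) • v), ?_, ?_⟩
  · apply intervalIntegral.continuous_parametric_intervalIntegral_of_continuous'
    fun_prop
  · intro y
    have hder : ∀ u ∈ uIcc (0 : ℝ) 1, HasDerivAt (fun u : ℝ => g (y - ((1 - u) * L y) • v))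
        (L y ^ (a + 1) * L' y ^ b * (u ^ a * H (y - ((1 - u) * L y) • v))) u := by
      intro u _
      have h1 : HasDerivAt (fun u : ℝ => y - ((1 - u) * L y) • v) (L y • v) u := by
        have := ((((hasDerivAt_id u).const_sub 1).mul_const (L y)).smul_const v).const_sub y
        simpa using this
      have h2 := ((hg.differentiable (by norm_num)) (y - ((1 - u) * L y) • v)).hasFDerivAt
      have h3 := h2.comp_hasDerivAt u h1
      have h4 := hgH (y - ((1 - u) * L y) • v)
      have h5 : (fderiv ℝ g (y - ((1 - u) * L y) • v)) (L y • v) =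
          L y ^ (a + 1) * L' y ^ b * (u ^ a * H (y - ((1 - u) * L y) • v)) := by
        rw [map_smul]
        unfold dirD at h4
        rw [h4]
        simp [hv, hv']
        ring
      rw [h5] at h3
      exact h3
    have := intervalIntegral.integral_eq_sub_of_hasDerivAt hder
      (by apply Continuous.intervalIntegrable; fun_prop)
    rw [intervalIntegral.integral_const_mul] at this
    rw [this]
    have hz : g (y - L y • v) = 0 := h0 _ (by simp [hv])
    simp [hz]

lemma model (L₁ L₂ : E →L[ℝ] ℝ) (v₁ v₂ : E) (h12 : L₁ v₂ = 0) (h21 : L₂ v₁ = 0) :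
    ∀ (s k₁ k₂ : ℕ), k₁ + k₂ = s → (k₁ ≠ 0 → L₁ v₁ = 1) → (k₂ ≠ 0 → L₂ v₂ = 1) →
    ∀ g : E → ℝ, ContDiff ℝ (s : ℕ∞) g → VanDir v₁ L₁ k₁ g → VanDir v₂ L₂ k₂ g →
    ∃ G : E → ℝ, Continuous G ∧ ∀ y, g y = L₁ y ^ k₁ * L₂ y ^ k₂ * G y := by
  intro s
  induction s with
  | zero =>
    intro k₁ k₂ hs _ _ g hg _ _
    obtain ⟨rfl, rfl⟩ : k₁ = 0 ∧ k₂ = 0 := by omega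
    exact ⟨g, hg.continuous, by simp⟩
  | succ s ih =>
    intro k₁ k₂ hs hL₁ hL₂ g hg hV₁ hV₂
    have hg1 : ContDiff ℝ ((1 : ℕ) : ℕ∞) g := hg.of_le (by norm_cast; omega)
    rcases k₁ with _ | k₁
    · rcases k₂ with _ | k₂
      · omega
      · obtain ⟨H, hH, hgH⟩ := ih 0 k₂ (by omega) (by simp) (fun _ => hL₂ (by simp)) (dirD v₂ g)
          (dirD_contDiff v₂ g s hg) (by intro y _ j hj; omega) hV₂.dir
        obtain ⟨G, hG, hgG⟩ := model_step L₂ L₁ v₂ (hL₂ (by simp)) h12 k₂ 0 g H hg1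
          (fun y hy => hV₂ y hy 0 (by simp)) hH (fun y => by rw [hgH y]; ring)
        exact ⟨G, hG, fun y => by rw [hgG y]; ring⟩
    · obtain ⟨H, hH, hgH⟩ := ih k₁ k₂ (by omega) (fun _ => hL₁ (by simp)) hL₂ (dirD v₁ g)
        (dirD_contDiff v₁ g s hg) hV₁.dir (hV₂.tangent hg (by omega) h21)
      exact model_step L₁ L₂ v₁ (hL₁ (by simp)) h21 k₁ k₂ g H hg1
          (fun y hy => hV₁ y hy 0 (by simp)) hH hgH

lemma dirD_iter_eq (v : E) (g : E → ℝ) (j : ℕ) : ∀ n : ℕ, j ≤ n → ContDiff ℝ (n : ℕ∞) g →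
    ∀ y, ((dirD v)^[j] g) y = iteratedFDeriv ℝ j g y (fun _ => v) := by
  induction j with
  | zero => intro n _ _ y; simp
  | succ j ih =>
    intro n hn hg y
    rw [Function.iterate_succ_apply', iteratedFDeriv_succ_apply_left]
    have e : (dirD v)^[j] g = fun y => iteratedFDeriv ℝ j g y (fun _ => v) :=
      funext (ih n (by omega) hg)
    rw [e]
    have hd : DifferentiableAt ℝ (iteratedFDeriv ℝ j g) y :=
      (hg.differentiable_iteratedFDeriv (by norm_cast)) y
    have h2 := ((ContinuousMultilinearMap.apply ℝ (fun _ : Fin j => E) ℝ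
      (fun _ => v)).hasFDerivAt.comp y hd.hasFDerivAt).fderiv
    unfold dirD
    have h3 := congrArg (fun T => T v) h2
    exact h3

/-- Vanishing of all derivatives of order `< l`, at a point, passes to compositions. -/
lemma vanish_comp {G : Type*} [NormedAddCommGroup G] [NormedSpace ℝ G]
    (f : G → ℝ) (ψ : E → G) (y : E) (l n : ℕ) (hl : l ≤ n)
    (hf : ContDiffAt ℝ (n : ℕ∞) f (ψ y)) (hψ : ContDiffAt ℝ (n : ℕ∞) ψ y)
    (h : ∀ j < l, iteratedFDeriv ℝ j f (ψ y) = 0) :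
    ∀ j < l, iteratedFDeriv ℝ j (f ∘ ψ) y = 0 := by
  intro j hj
  rw [iteratedFDeriv_comp hf hψ (by norm_cast; omega)]
  unfold FormalMultilinearSeries.taylorComp
  refine Finset.sum_eq_zero fun c _ => ?_
  ext w
  rw [FormalMultilinearSeries.compAlongOrderedFinpartition_apply]
  have : ftaylorSeries ℝ f (ψ y) c.length = 0 := h _ (lt_of_le_of_lt c.length_le hj)
  rw [this]; rfl

lemma vanish_mul (χ g : E → ℝ) (V : Set E) (hV : IsOpen V) (y : E) (hy : y ∈ V) (l n : ℕ)
    (hl : l ≤ n) (hχ : ContDiffOn ℝ (n : ℕ∞) χ V) (hg : ContDiffOn ℝ (n : ℕ∞) g V)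
    (h : ∀ j < l, iteratedFDeriv ℝ j g y = 0) :
    ∀ j < l, iteratedFDeriv ℝ j (fun z => χ z * g z) y = 0 := by
  intro j hj
  have := norm_iteratedFDerivWithin_mul_le hχ hg hV.uniqueDiffOn hy (n := j) (by norm_cast; omega)
  rw [Finset.sum_eq_zero, iteratedFDerivWithin_of_isOpen j hV hy] at this
  · simpa using this
  · intro i hi
    rw [iteratedFDerivWithin_of_isOpen (j - i) hV hy, h (j - i) (by omega)]; simp

lemma local_div [FiniteDimensional ℝ E] (k k₁ k₂ : ℕ) (hk : k₁ + k₂ = k)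
    (φ₁ φ₂ : E → ℝ)
    (hφ₁ : ContDiff ℝ (⊤ : ℕ∞) φ₁) (hφ₂ : ContDiff ℝ (⊤ : ℕ∞) φ₂)
    (f : E → ℝ) (hf : ContDiff ℝ (k : ℕ∞) f)
    (hvan₁ : ∀ x, φ₁ x = 0 → ∀ j : ℕ, j < k₁ → iteratedFDeriv ℝ j f x = 0)
    (hvan₂ : ∀ x, φ₂ x = 0 → ∀ j : ℕ, j < k₂ → iteratedFDeriv ℝ j f x = 0)
    (x₀ : E) (v₁ v₂ : E)
    (h11 : k₁ ≠ 0 → fderiv ℝ φ₁ x₀ v₁ = 1) (h22 : k₂ ≠ 0 → fderiv ℝ φ₂ x₀ v₂ = 1)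
    (h12 : fderiv ℝ φ₁ x₀ v₂ = 0) (h21 : fderiv ℝ φ₂ x₀ v₁ = 0) :
    ∃ U ∈ 𝓝 x₀, ∃ F : E → ℝ, Continuous F ∧ ∀ x ∈ U, f x = φ₁ x ^ k₁ * φ₂ x ^ k₂ * F x := by
  haveI : CompleteSpace E := FiniteDimensional.complete ℝ E
  set L₁ := fderiv ℝ φ₁ x₀ with hL₁
  set L₂ := fderiv ℝ φ₂ x₀ with hL₂
  set Φ : E → E := fun x => x + (φ₁ x - L₁ x) • v₁ + (φ₂ x - L₂ x) • v₂ with hΦ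
  have hΦs : ContDiff ℝ ((k + 1 : ℕ) : ℕ∞) Φ := by
    have a1 : ContDiff ℝ ((k + 1 : ℕ) : ℕ∞) φ₁ := hφ₁.of_le (by exact_mod_cast le_top)
    have a2 : ContDiff ℝ ((k + 1 : ℕ) : ℕ∞) φ₂ := hφ₂.of_le (by exact_mod_cast le_top)
    have b1 : ContDiff ℝ ((k + 1 : ℕ) : ℕ∞) L₁ := L₁.contDiff
    have b2 : ContDiff ℝ ((k + 1 : ℕ) : ℕ∞) L₂ := L₂.contDiff
    exact (contDiff_id.add ((a1.sub b1).smul contDiff_const)).add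
      ((a2.sub b2).smul contDiff_const)
  have hΦd : HasFDerivAt Φ ((ContinuousLinearEquiv.refl ℝ E : E ≃L[ℝ] E) : E →L[ℝ] E) x₀ := by
    have d1 : HasFDerivAt φ₁ L₁ x₀ := (hφ₁.differentiable (by simp) x₀).hasFDerivAt
    have d2 : HasFDerivAt φ₂ L₂ x₀ := (hφ₂.differentiable (by simp) x₀).hasFDerivAt
    have := ((hasFDerivAt_id x₀).add ((d1.sub L₁.hasFDerivAt).smul_const v₁)).add
      ((d2.sub L₂.hasFDerivAt).smul_const v₂)
    refine this.congr_fderiv ?_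
    ext; simp
  have hΦL₁ : k₁ ≠ 0 → ∀ x, L₁ (Φ x) = φ₁ x := by
    intro h x; simp [hΦ, h11 h, h12]
  have hΦL₂ : k₂ ≠ 0 → ∀ x, L₂ (Φ x) = φ₂ x := by
    intro h x; simp [hΦ, h22 h, h21]
  have hn : (((k + 1 : ℕ) : ℕ∞) : WithTop ℕ∞) ≠ 0 := by norm_cast
  set e := hΦs.contDiffAt.toOpenPartialHomeomorph Φ hΦd hn with he
  have hecoe : ∀ x, e x = Φ x := fun x => rfl
  have hx₀ : x₀ ∈ e.source := hΦs.contDiffAt.mem_toOpenPartialHomeomorph_source hΦd hn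
  have hy₀ : Φ x₀ ∈ e.target := hΦs.contDiffAt.image_mem_toOpenPartialHomeomorph_target hΦd hn
  have hinv : ContDiffAt ℝ ((k + 1 : ℕ) : ℕ∞) e.symm (Φ x₀) :=
    hΦs.contDiffAt.to_localInverse hΦd hn
  have hinv' : ContDiffAt ℝ (k : ℕ∞) e.symm (Φ x₀) := hinv.of_le (by norm_cast; omega)
  have hev := (hinv'.eventually (by simp)).and (e.open_target.mem_nhds hy₀)
  obtain ⟨r, hr, hball⟩ := Metric.eventually_nhds_iff_ball.1 hev
  set V := Metric.ball (Φ x₀) r with hV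
  let χ : ContDiffBump (Φ x₀) := ⟨r / 4, r / 2, by positivity, by linarith⟩
  have hχV : tsupport χ ⊆ V := by
    rw [χ.tsupport_eq]; exact Metric.closedBall_subset_ball (by change r / 2 < r; linarith)
  set g : E → ℝ := fun y => χ y * (f ∘ e.symm) y with hg
  have hfe : ContDiffOn ℝ (k : ℕ∞) (f ∘ e.symm) V := fun y hy =>
    (hf.contDiffAt.comp y (hball y hy).1).contDiffWithinAt
  have hχs : ContDiff ℝ (k : ℕ∞) χ := χ.contDiff
  have hg0 : ∀ y, y ∉ V → g =ᶠ[𝓝 y] fun _ => 0 := by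
    intro y hy
    have : (tsupport χ)ᶜ ∈ 𝓝 y :=
      (isClosed_tsupport _).isOpen_compl.mem_nhds (fun h => hy (hχV h))
    filter_upwards [this] with z hz
    simp [hg, image_eq_zero_of_notMem_tsupport hz]
  have hgs : ContDiff ℝ (k : ℕ∞) g := by
    rw [contDiff_iff_contDiffAt]
    intro y
    by_cases hy : y ∈ V
    · exact hχs.contDiffAt.mul (hfe.contDiffAt (Metric.isOpen_ball.mem_nhds hy))
    · exact contDiffAt_const.congr_of_eventuallyEq (hg0 y hy)
  have hgvan : ∀ (φ : E → ℝ) (L : E →L[ℝ] ℝ) (v : E) (l : ℕ), l ≤ k →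
      (l ≠ 0 → ∀ x, L (Φ x) = φ x) →
      (∀ x, φ x = 0 → ∀ j : ℕ, j < l → iteratedFDeriv ℝ j f x = 0) → VanDir v L l g := by
    intro φ L v l hl hL hφ y hLy j hj
    rw [dirD_iter_eq v g j k (by omega) hgs]
    have : iteratedFDeriv ℝ j g y = 0 := by
      by_cases hy : y ∈ V
      · refine vanish_mul χ (f ∘ e.symm) V Metric.isOpen_ball y hy l k hl hχs.contDiffOn hfe ?_ j hj
        refine vanish_comp f e.symm y l k hl hf.contDiffAt (hball y hy).1 (hφ _ ?_)
        rw [← hL (by omega), ← hecoe, e.right_inv (hball y hy).2, hLy]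
      · rw [(hg0 y hy).iteratedFDeriv ℝ j |>.eq_of_nhds]
        simp
    rw [this]; rfl
  obtain ⟨G, hG, hgG⟩ := model L₁ L₂ v₁ v₂ h12 h21 k k₁ k₂ hk h11 h22 g hgs
    (hgvan φ₁ L₁ v₁ k₁ (by omega) hΦL₁ hvan₁) (hgvan φ₂ L₂ v₂ k₂ (by omega) hΦL₂ hvan₂)
  have hχ1 : ∀ᶠ x in 𝓝 x₀, χ (Φ x) = 1 :=
    hΦs.continuous.continuousAt.eventually χ.eventuallyEq_one
  refine ⟨_, hχ1.and (e.open_source.mem_nhds hx₀), fun x => G (Φ x),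
    hG.comp hΦs.continuous, ?_⟩
  rintro x ⟨hx1, hx2⟩
  have h1 := hgG (Φ x)
  have h2 : g (Φ x) = f x := by
    simp only [hg, Function.comp, hx1, one_mul]
    rw [← hecoe, e.left_inv hx2]
  have p1 : L₁ (Φ x) ^ k₁ = φ₁ x ^ k₁ := by
    by_cases h : k₁ = 0
    · simp [h]
    · rw [hΦL₁ h]
  have p2 : L₂ (Φ x) ^ k₂ = φ₂ x ^ k₂ := by
    by_cases h : k₂ = 0
    · simp [h]
    · rw [hΦL₂ h]
  rw [← h2, h1, p1, p2]

lemma exists_dual_vec (L M : E →L[ℝ] ℝ) (h : LinearIndependent ℝ ![L, M]) :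
    ∃ v, L v = 1 ∧ M v = 0 := by
  rw [LinearIndependent.pair_iff] at h
  by_contra hcon
  push Not at hcon
  have hker : ∀ v, M v = 0 → L v = 0 := by
    intro v hv
    by_contra hL
    exact hcon ((L v)⁻¹ • v) (by simp [hL]) (by simp [hv])
  have hM : M ≠ 0 := by
    rintro rfl
    exact one_ne_zero (h 0 1 (by simp)).2
  obtain ⟨w, hw⟩ : ∃ w, M w ≠ 0 := by
    by_contra hc
    push Not at hc
    exact hM (ContinuousLinearMap.ext hc)
  have := (h 1 (-(L w / M w)) (by
    ext u
    have := hker (u - (M u / M w) • w) (by simp [hw])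
    simp only [map_sub, map_smul, smul_eq_mul] at this
    simp only [ContinuousLinearMap.add_apply, ContinuousLinearMap.smul_apply, smul_eq_mul,
      ContinuousLinearMap.zero_apply]
    rw [← this]; ring)).1
  exact one_ne_zero this

lemma exists_dual_vec_single (L : E →L[ℝ] ℝ) (h : L ≠ 0) : ∃ v, L v = 1 := by
  obtain ⟨w, hw⟩ : ∃ w, L w ≠ 0 := by
    by_contra hc
    push Not at hc
    exact h (ContinuousLinearMap.ext hc)
  exact ⟨(L w)⁻¹ • w, by simp [hw]⟩

end Model

/-- Let `m ≥ 1`, `k, k₁, k₂ ∈ ℕ` with `k₁ + k₂ ≤ k`.  Let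
`φ₁, φ₂ : ℝᵐ → ℝ` be smooth functions defining hypersurfaces `Hᵢ = φᵢ⁻¹(0)` with
nonvanishing differentials along `Hᵢ` which intersect transversally.  Let
`f : ℝᵐ → ℝ` be a `C^k`-function vanishing to order `k₁` along `H₁` and to order
`k₂` along `H₂` (all iterated Fréchet derivatives of order `< kᵢ` vanish on `Hᵢ`).
Then there is a continuous `F : ℝᵐ → ℝ` with `f = φ₁^{k₁} · φ₂^{k₂} · F`. -/
theorem division_by_transversal_hypersurfaces
    (m : ℕ) (hm : 1 ≤ m) (k k₁ k₂ : ℕ) (hk : k₁ + k₂ ≤ k)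
    (φ₁ φ₂ : (Fin m → ℝ) → ℝ)
    (hφ₁ : ContDiff ℝ (⊤ : ℕ∞) φ₁) (hφ₂ : ContDiff ℝ (⊤ : ℕ∞) φ₂)
    (hreg₁ : ∀ x : Fin m → ℝ, φ₁ x = 0 → fderiv ℝ φ₁ x ≠ 0)
    (hreg₂ : ∀ x : Fin m → ℝ, φ₂ x = 0 → fderiv ℝ φ₂ x ≠ 0)
    (htrans : ∀ x : Fin m → ℝ, φ₁ x = 0 → φ₂ x = 0 →
      LinearIndependent ℝ ![fderiv ℝ φ₁ x, fderiv ℝ φ₂ x])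
    (f : (Fin m → ℝ) → ℝ) (hf : ContDiff ℝ (k : ℕ∞) f)
    (hvan₁ : ∀ x : Fin m → ℝ, φ₁ x = 0 → ∀ j : ℕ, j < k₁ → iteratedFDeriv ℝ j f x = 0)
    (hvan₂ : ∀ x : Fin m → ℝ, φ₂ x = 0 → ∀ j : ℕ, j < k₂ → iteratedFDeriv ℝ j f x = 0) :
    ∃ F : (Fin m → ℝ) → ℝ, Continuous F ∧
      ∀ x : Fin m → ℝ, f x = φ₁ x ^ k₁ * φ₂ x ^ k₂ * F x := by
  have hloc : ∀ x₀ : Fin m → ℝ, ∃ U ∈ 𝓝 x₀, ∃ F : (Fin m → ℝ) → ℝ, ContinuousOn F U ∧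
      ∀ x ∈ U, F x ∈ {r : ℝ | f x = φ₁ x ^ k₁ * φ₂ x ^ k₂ * r} := by
    intro x₀
    have hz : ContDiff ℝ (⊤ : ℕ∞) (fun _ : Fin m → ℝ => (0 : ℝ)) := contDiff_const
    have hn₁ : φ₁ x₀ ≠ 0 → {x | φ₁ x ≠ 0} ∈ 𝓝 x₀ := fun h =>
      hφ₁.continuous.continuousAt.eventually_ne h
    have hn₂ : φ₂ x₀ ≠ 0 → {x | φ₂ x ≠ 0} ∈ 𝓝 x₀ := fun h =>
      hφ₂.continuous.continuousAt.eventually_ne h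
    have hc₁ := hφ₁.continuous
    have hc₂ := hφ₂.continuous
    have hfl : ∀ l : ℕ, l ≤ k → ContDiff ℝ (l : ℕ∞) f := fun l hl =>
      hf.of_le (by exact_mod_cast hl)
    by_cases z₁ : φ₁ x₀ = 0
    · by_cases z₂ : φ₂ x₀ = 0
      · have hli := htrans x₀ z₁ z₂
        obtain ⟨v₁, h11, h21⟩ := exists_dual_vec _ _ hli
        obtain ⟨v₂, h22, h12⟩ := exists_dual_vec _ _ (LinearIndependent.pair_symm_iff.1 hli)
        obtain ⟨U, hU, F, hF, h⟩ := local_div (k₁ + k₂) k₁ k₂ rfl φ₁ φ₂ hφ₁ hφ₂ f (hfl _ hk)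
          hvan₁ hvan₂ x₀ v₁ v₂ (fun _ => h11) (fun _ => h22) h12 h21
        exact ⟨U, hU, F, hF.continuousOn, h⟩
      · obtain ⟨v₁, h11⟩ := exists_dual_vec_single _ (hreg₁ x₀ z₁)
        obtain ⟨U, hU, F, hF, h⟩ := local_div k₁ k₁ 0 rfl φ₁ (fun _ => 0) hφ₁ hz f
          (hfl _ (by omega)) hvan₁ (by intro x _ j hj; omega) x₀ v₁ 0 (fun _ => h11)
          (by simp) (by simp) (by simp)
        refine ⟨U ∩ {x | φ₂ x ≠ 0}, inter_mem hU (hn₂ z₂), fun x => F x / φ₂ x ^ k₂,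
          hF.continuousOn.div (hc₂.pow k₂).continuousOn (fun x hx => pow_ne_zero _ hx.2), ?_⟩
        rintro x ⟨hx, hx2⟩
        have hx2' : φ₂ x ≠ 0 := hx2
        have := h x hx
        simp only [mem_setOf_eq]
        rw [this]; field_simp; try simp
    · by_cases z₂ : φ₂ x₀ = 0
      · obtain ⟨v₂, h22⟩ := exists_dual_vec_single _ (hreg₂ x₀ z₂)
        obtain ⟨U, hU, F, hF, h⟩ := local_div k₂ k₂ 0 rfl φ₂ (fun _ => 0) hφ₂ hz f
          (hfl _ (by omega)) hvan₂ (by intro x _ j hj; omega) x₀ v₂ 0 (fun _ => h22)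
          (by simp) (by simp) (by simp)
        refine ⟨U ∩ {x | φ₁ x ≠ 0}, inter_mem hU (hn₁ z₁), fun x => F x / φ₁ x ^ k₁,
          hF.continuousOn.div (hc₁.pow k₁).continuousOn (fun x hx => pow_ne_zero _ hx.2), ?_⟩
        rintro x ⟨hx, hx2⟩
        have hx2' : φ₁ x ≠ 0 := hx2
        have := h x hx
        simp only [mem_setOf_eq]
        rw [this]; field_simp; try simp
      · refine ⟨{x | φ₁ x ≠ 0} ∩ {x | φ₂ x ≠ 0}, inter_mem (hn₁ z₁) (hn₂ z₂),
          fun x => f x / (φ₁ x ^ k₁ * φ₂ x ^ k₂),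
          hf.continuous.continuousOn.div ((hc₁.pow k₁).mul (hc₂.pow k₂)).continuousOn
            (fun x hx => mul_ne_zero (pow_ne_zero _ hx.1) (pow_ne_zero _ hx.2)), ?_⟩
        rintro x ⟨hx1, hx2⟩
        have hx1' : φ₁ x ≠ 0 := hx1
        have hx2' : φ₂ x ≠ 0 := hx2
        simp only [mem_setOf_eq]
        field_simp
  have hconv : ∀ x : Fin m → ℝ, Convex ℝ {r : ℝ | f x = φ₁ x ^ k₁ * φ₂ x ^ k₂ * r} := by
    intro x a ha b hb s t _ _ hst
    simp only [mem_setOf_eq, smul_eq_mul] at *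
    calc f x = s * f x + t * f x := by rw [← add_mul, hst, one_mul]
      _ = s * (φ₁ x ^ k₁ * φ₂ x ^ k₂ * a) + t * (φ₁ x ^ k₁ * φ₂ x ^ k₂ * b) := by
        rw [← ha, ← hb]
      _ = _ := by ring
  obtain ⟨F, hF⟩ := exists_continuous_forall_mem_convex_of_local hconv hloc
  exact ⟨F, F.continuous, hF⟩
end

section
/- For every l ∈ ℕ and every real number β with β ≥ l + 1 there exists a constant C = C(l, β) > 0 with the following property: for every smooth function σ : ℝ → ℝ vanishing outside the interval [−1, 1] and every ε with 0 < ε ≤ 1, the function g_ε(t) = σ(t/ε)·t^β satisfies |g_ε^{(l)}(t)| ≤ ε·C·‖σ‖_{C^l(ℝ)} for all t > 0, where g_ε^{(l)} denotes the l-th derivative and t^β the real power of t > 0. -/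
/-- For every `l ∈ ℕ` and every real `β ≥ l + 1` there is a
constant `C = C(l, β) > 0` such that for every smooth function `σ : ℝ → ℝ`
vanishing outside `[−1, 1]` and every `0 < ε ≤ 1`, the function
`g_ε(t) = σ(t/ε) t^β` satisfies `|g_ε^{(l)}(t)| ≤ ε · C · ‖σ‖_{C^l(ℝ)}` for all
`t > 0`, where `‖σ‖_{C^l(ℝ)} = max_{0 ≤ j ≤ l} sup_t |σ^{(j)}(t)|`. -/
theorem cutoff_power_derivative_bound
    (l : ℕ) (β : ℝ) (hβ : (l : ℝ) + 1 ≤ β) :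
    ∃ C : ℝ, 0 < C ∧
      ∀ σ : ℝ → ℝ, ContDiff ℝ (⊤ : ℕ∞) σ →
        (∀ t : ℝ, t ∉ Set.Icc (-1 : ℝ) 1 → σ t = 0) →
        ∀ ε : ℝ, 0 < ε → ε ≤ 1 →
          ∀ t : ℝ, 0 < t →
            |iteratedDeriv l (fun s : ℝ => σ (s / ε) * s ^ β) t| ≤
              ε * C * (Finset.range (l + 1)).sup'
                (by simp) (fun j => ⨆ s : ℝ, |iteratedDeriv j σ s|) := by
  have hz : ∀ σ : ℝ → ℝ, (∀ t : ℝ, t ∉ Set.Icc (-1 : ℝ) 1 → σ t = 0) →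
      ∀ (j : ℕ) (s : ℝ), s ∉ Set.Icc (-1 : ℝ) 1 → iteratedDeriv j σ s = 0 := by
    intro σ h j s hs
    have := Set.EqOn.iteratedDeriv_of_isOpen (f := σ) (g := fun _ => (0 : ℝ))
      (s := (Set.Icc (-1 : ℝ) 1)ᶜ) (fun x hx => h x hx) isClosed_Icc.isOpen_compl j hs
    simpa using this
  have hnn : 0 ≤ ∑ i ∈ Finset.range (l + 1),
      (l.choose i : ℝ) * |(descPochhammer ℝ (l - i)).eval β| :=
    Finset.sum_nonneg fun i _ => by positivity
  refine ⟨1 + ∑ i ∈ Finset.range (l + 1),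
    (l.choose i : ℝ) * |(descPochhammer ℝ (l - i)).eval β|, by linarith, ?_⟩
  intro σ hσ hsupp ε hε hε1 t ht
  have hbdd : ∀ j : ℕ, BddAbove (Set.range fun s : ℝ => |iteratedDeriv j σ s|) := by
    intro j
    have hc : Continuous (iteratedDeriv j σ) :=
      hσ.continuous_iteratedDeriv j (by exact_mod_cast le_top)
    obtain ⟨B, hB⟩ := (isCompact_Icc (a := (-1 : ℝ)) (b := 1)).exists_bound_of_continuousOn
      hc.continuousOn
    refine ⟨max B 0, ?_⟩
    rintro _ ⟨s, rfl⟩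
    by_cases hs : s ∈ Set.Icc (-1 : ℝ) 1
    · exact le_max_of_le_left (hB s hs)
    · simp [hz σ hsupp j s hs]
  set M := (Finset.range (l + 1)).sup' (by simp) (fun j => ⨆ s : ℝ, |iteratedDeriv j σ s|)
    with hM
  have hMb : ∀ j ∈ Finset.range (l + 1), ∀ s, |iteratedDeriv j σ s| ≤ M := fun j hj s =>
    (le_ciSup (hbdd j) s).trans
      (Finset.le_sup' (fun j => ⨆ s : ℝ, |iteratedDeriv j σ s|) hj)
  have hM0 : 0 ≤ M := (abs_nonneg _).trans (hMb 0 (by simp) 0)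
  by_cases hte : t ≤ ε
  swap
  · push Not at hte
    have hmem : Set.EqOn (fun s : ℝ => σ (s / ε) * s ^ β) (fun _ => (0 : ℝ)) (Set.Ioi ε) := by
      intro s hs
      have : σ (s / ε) = 0 := hsupp _ fun h => by
        have h1 : 1 < s / ε := (one_lt_div hε).2 hs
        exact absurd h.2 (not_le.2 h1)
      simp [this]
    have h0 := hmem.iteratedDeriv_of_isOpen isOpen_Ioi l hte
    rw [h0]
    simp only [iteratedDeriv_fun_const_zero, abs_zero]
    positivity
  have hf : ContDiffAt ℝ l (fun s : ℝ => σ (s / ε)) t :=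
    ((hσ.of_le (by exact_mod_cast le_top)).comp (contDiff_id.div_const ε)).contDiffAt
  have hg : ContDiffAt ℝ l (fun s : ℝ => s ^ β) t :=
    Real.contDiffAt_rpow_const (Or.inl ht.ne')
  rw [iteratedDeriv_fun_mul hf hg]
  refine (Finset.abs_sum_le_sum_abs _ _).trans ?_
  have hterm : ∀ i ∈ Finset.range (l + 1),
      |(l.choose i : ℝ) * iteratedDeriv i (fun s : ℝ => σ (s / ε)) t *
        iteratedDeriv (l - i) (fun s : ℝ => s ^ β) t| ≤
      ε * ((l.choose i : ℝ) * |(descPochhammer ℝ (l - i)).eval β|) * M := by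
    intro i hi
    have hil : i ≤ l := Nat.lt_succ_iff.1 (Finset.mem_range.1 hi)
    have h1 : iteratedDeriv i (fun s : ℝ => σ (s / ε)) t
        = (ε ^ i)⁻¹ * iteratedDeriv i σ (t / ε) := by
      have := congrFun (iteratedDeriv_comp_const_mul (n := i) (f := σ)
        (hσ.of_le (by exact_mod_cast le_top)) ε⁻¹) t
      simpa [div_eq_inv_mul] using this
    have h2 : iteratedDeriv (l - i) (fun s : ℝ => s ^ β) t
        = (descPochhammer ℝ (l - i)).eval β * t ^ (β - (l - i : ℕ)) := by
      rw [iteratedDeriv_eq_iterate, Real.iter_deriv_rpow_const]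
    have h3 : t ^ (β - (l - i : ℕ)) ≤ ε ^ i * ε := by
      rw [Nat.cast_sub hil]
      calc t ^ (β - ((l : ℝ) - i)) ≤ ε ^ (β - ((l : ℝ) - i)) :=
            Real.rpow_le_rpow ht.le hte (by
              have : (0 : ℝ) ≤ i := Nat.cast_nonneg i
              linarith)
        _ ≤ ε ^ ((i : ℝ) + 1) := Real.rpow_le_rpow_of_exponent_ge hε hε1 (by linarith)
        _ = ε ^ i * ε := by rw [Real.rpow_add hε, Real.rpow_natCast, Real.rpow_one]
    have h4 : 0 ≤ t ^ (β - (l - i : ℕ)) := Real.rpow_nonneg ht.le _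
    have hεi : 0 < ε ^ i := pow_pos hε i
    rw [h1, h2]
    simp only [abs_mul, abs_inv, abs_of_pos hεi, abs_of_nonneg h4, Nat.abs_cast]
    calc (l.choose i : ℝ) * ((ε ^ i)⁻¹ * |iteratedDeriv i σ (t / ε)|) *
          (|(descPochhammer ℝ (l - i)).eval β| * t ^ (β - (l - i : ℕ)))
        ≤ (l.choose i : ℝ) * ((ε ^ i)⁻¹ * M) *
          (|(descPochhammer ℝ (l - i)).eval β| * (ε ^ i * ε)) := by
          have := hMb i hi (t / ε)
          gcongr
      _ = ε * ((l.choose i : ℝ) * |(descPochhammer ℝ (l - i)).eval β|) * M := by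
          field_simp
  refine (Finset.sum_le_sum hterm).trans ?_
  rw [← Finset.sum_mul, ← Finset.mul_sum]
  gcongr
  linarith
end
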